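/- arXiv:2311.15043 — 3 statements merged into one kernel-verified Lean document; each statement's English description precedes it below -/
import Mathlib

section
/- For every α ∈ (0,π) and every finite collinear set P ⊂ ℝ² of n ≥ 3 points (all points of P lie on one line), every plane α-bend graph on P has at most 3n−6 edges, and there exists a plane α-bend graph on P with exactly 3n−6 edges. -/
open EuclideanGeometry Real Set

noncomputable section

/-- The Euclidean plane. -/
abbrev Pt : Type := EuclideanSpace ℝ (Fin 2)

/-- The image of a one-bend edge `(a,b,c)`: the union of segments `[a,b]` and `[b,c]`. -/
def bendImage (e : Pt × Pt × Pt) : Set Pt :=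
  segment ℝ e.1 e.2.1 ∪ segment ℝ e.2.1 e.2.2

/-- The endpoints of a (bend or arc) edge `(a,b,c)` are `a` and `c`. -/
def edgeEndpoints (e : Pt × Pt × Pt) : Set Pt := {e.1, e.2.2}

/-- An `α`-bend edge: a triple `(a,b,c)` with `a ≠ c` and angle `α` at `b`. -/
def IsBendEdge (α : ℝ) (e : Pt × Pt × Pt) : Prop :=
  e.1 ≠ e.2.2 ∧ ∠ e.1 e.2.1 e.2.2 = α

/-- A plane `α`-bend multigraph on a finite vertex set `V`. -/
def IsPlaneBendMultigraph (α : ℝ) (V : Finset Pt) (E : Finset (Pt × Pt × Pt)) : Prop :=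
  (∀ e ∈ E, IsBendEdge α e ∧ e.1 ∈ V ∧ e.2.2 ∈ V) ∧
  (∀ e ∈ E, ∀ f ∈ E, e ≠ f → bendImage e ≠ bendImage f) ∧
  (∀ e ∈ E, ∀ v ∈ V, (v : Pt) ∈ bendImage e → (v : Pt) ∈ edgeEndpoints e) ∧
  (∀ e ∈ E, ∀ f ∈ E, e ≠ f →
    bendImage e ∩ bendImage f ⊆ edgeEndpoints e ∩ edgeEndpoints f)

/-- A plane `α`-bend graph: a plane `α`-bend multigraph in which distinct edges
have distinct endpoint pairs. -/
def IsPlaneBendGraph (α : ℝ) (V : Finset Pt) (E : Finset (Pt × Pt × Pt)) : Prop :=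
  IsPlaneBendMultigraph α V E ∧
  ∀ e ∈ E, ∀ f ∈ E, e ≠ f → edgeEndpoints e ≠ edgeEndpoints f

/-- An `α`-arc edge: a triple `(a,b,c)` with `a ≠ c`, `b` off of the line `ac`,
and angle `α` at `b`. -/
def IsArcEdge (α : ℝ) (e : Pt × Pt × Pt) : Prop :=
  e.1 ≠ e.2.2 ∧ e.2.1 ∉ affineSpan ℝ ({e.1, e.2.2} : Set Pt) ∧ ∠ e.1 e.2.1 e.2.2 = α

/-- The image of an arc edge `(a,b,c)`: `{a,c}` together with the points strictly on the
same side of line `ac` as `b` from which the segment `ac` subtends the same angle as at `b`. -/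
def arcImage (e : Pt × Pt × Pt) : Set Pt :=
  ({e.1, e.2.2} : Set Pt) ∪
    {x : Pt | (affineSpan ℝ ({e.1, e.2.2} : Set Pt)).SSameSide x e.2.1 ∧
      ∠ e.1 x e.2.2 = ∠ e.1 e.2.1 e.2.2}

/-- A plane `α`-arc multigraph on a finite vertex set `V`. -/
def IsPlaneArcMultigraph (α : ℝ) (V : Finset Pt) (E : Finset (Pt × Pt × Pt)) : Prop :=
  (∀ e ∈ E, IsArcEdge α e ∧ e.1 ∈ V ∧ e.2.2 ∈ V) ∧
  (∀ e ∈ E, ∀ f ∈ E, e ≠ f → arcImage e ≠ arcImage f) ∧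
  (∀ e ∈ E, ∀ v ∈ V, (v : Pt) ∈ arcImage e → (v : Pt) ∈ edgeEndpoints e) ∧
  (∀ e ∈ E, ∀ f ∈ E, e ≠ f →
    arcImage e ∩ arcImage f ⊆ edgeEndpoints e ∩ edgeEndpoints f)

/-- A plane `α`-arc graph: a plane `α`-arc multigraph in which distinct edges
have distinct endpoint pairs. -/
def IsPlaneArcGraph (α : ℝ) (V : Finset Pt) (E : Finset (Pt × Pt × Pt)) : Prop :=
  IsPlaneArcMultigraph α V E ∧
  ∀ e ∈ E, ∀ f ∈ E, e ≠ f → edgeEndpoints e ≠ edgeEndpoints f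

/-- A finite point set is in general position if no three of its points are collinear. -/
def GenPos (P : Finset Pt) : Prop :=
  ∀ p ∈ P, ∀ q ∈ P, ∀ r ∈ P, p ≠ q → p ≠ r → q ≠ r →
    ¬ Collinear ℝ ({p, q, r} : Set Pt)

/-- A planar straight-line graph on `P`: edges are (ordered representatives of unordered)
pairs of distinct points of `P` whose closed segments pairwise intersect only in shared
endpoints, and no segment contains a point of `P` other than its endpoints. -/
def IsPSLG (P : Finset Pt) (E : Finset (Pt × Pt)) : Prop :=
  (∀ e ∈ E, e.1 ∈ P ∧ e.2 ∈ P ∧ e.1 ≠ e.2) ∧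
  (∀ e ∈ E, ∀ f ∈ E, e ≠ f → segment ℝ e.1 e.2 ≠ segment ℝ f.1 f.2) ∧
  (∀ e ∈ E, ∀ p ∈ P, (p : Pt) ∈ segment ℝ e.1 e.2 → p = e.1 ∨ p = e.2) ∧
  (∀ e ∈ E, ∀ f ∈ E, e ≠ f →
    segment ℝ e.1 e.2 ∩ segment ℝ f.1 f.2 ⊆ ({e.1, e.2} : Set Pt) ∩ ({f.1, f.2} : Set Pt))

/-- `M P`: the maximum number of edges of a planar straight-line graph on `P`. -/
def M (P : Finset Pt) : ℕ :=
  sSup {m : ℕ | ∃ E : Finset (Pt × Pt), IsPSLG P E ∧ E.card = m}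

/-- Two segments (given by their endpoint pairs) cross: they meet in exactly one point,
which lies in the relative interior (open segment) of both. -/
def SegCross (s t : Pt × Pt) : Prop :=
  ∃ x : Pt, segment ℝ s.1 s.2 ∩ segment ℝ t.1 t.2 = {x} ∧
    x ∈ openSegment ℝ s.1 s.2 ∧ x ∈ openSegment ℝ t.1 t.2

/-! ### Combinatorics -/

lemma comb_page (n : ℕ) (S : Finset (ℕ × ℕ))
    (h : ∀ e ∈ S, e.1 + 1 < e.2 ∧ e.2 < n)
    (hnc : ∀ e ∈ S, ∀ f ∈ S, ¬ (e.1 < f.1 ∧ f.1 < e.2 ∧ e.2 < f.2)) :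
    S.card ≤ n - 2 := by
  classical
  have hk : ∀ e ∈ S, ∃ k, e.1 < k ∧ k < e.2 ∧ ((e.1, k) ∈ S ∨ k = e.1 + 1) ∧
      ∀ m, k < m → m < e.2 → (e.1, m) ∉ S := by
    intro e he
    have h1 := h e he
    let T := (Finset.range e.2).filter (fun k => (e.1, k) ∈ S ∨ k = e.1 + 1)
    have hT : T.Nonempty := ⟨e.1 + 1, by simp [T]; omega⟩
    have hm := T.max'_mem hT
    simp only [T, Finset.mem_filter, Finset.mem_range] at hm
    refine ⟨T.max' hT, ?_, hm.1, hm.2, ?_⟩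
    · rcases hm.2 with h2 | h2
      · have := (h _ h2).1
        simp only [T] at this ⊢
        omega
      · simp only [T] at h2 ⊢
        omega
    · intro m hm1 hm2 hm3
      have : m ≤ T.max' hT := T.le_max' m (by simp [T, hm2, hm3])
      omega
  choose! k hk1 hk2 hk3 hk4 using hk
  have key : ∀ e ∈ S, ∀ f ∈ S, k e = k f → e.1 ≤ f.1 → f.2 ≤ e.2 → e = f := by
    intro e he f hf hef h1 h2
    have a1 := hk1 e he
    have a2 := hk2 e he
    have b1 := hk1 f hf
    have b2 := hk2 f hf
    have h11 : e.1 = f.1 := by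
      rcases hk3 e he with h3 | h3
      · by_contra hne
        exact hnc _ h3 f hf ⟨by simp; omega, by simp; omega, by simp; omega⟩
      · omega
    have h22 : e.2 = f.2 := by
      by_contra hne
      apply hk4 e he f.2 (by omega) (by omega)
      rw [h11]; exact hf
    exact Prod.ext h11 h22
  have hinj : Set.InjOn k (S : Set (ℕ × ℕ)) := by
    intro e he f hf hef
    have he' : e ∈ S := he
    have hf' : f ∈ S := hf
    have a1 := hk1 e he
    have a2 := hk2 e he
    have b1 := hk1 f hf
    have b2 := hk2 f hf
    have c1 := hnc e he f hf
    have c2 := hnc f hf e he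
    by_cases hc : e.1 ≤ f.1 ∧ f.2 ≤ e.2
    · exact key e he f hf hef hc.1 hc.2
    · exact (key f hf e he hef.symm (by omega) (by omega)).symm
  have hsub : S.image k ⊆ Finset.Ioo 0 (n - 1) := by
    intro m hm
    obtain ⟨e, he, rfl⟩ := Finset.mem_image.1 hm
    have a1 := hk1 e he
    have a2 := hk2 e he
    have a3 := h e he
    simp only [Finset.mem_Ioo]
    omega
  have := Finset.card_le_card hsub
  rw [Finset.card_image_of_injOn hinj, Nat.card_Ioo] at this
  omega

lemma comb_page' (n : ℕ) (hn : 3 ≤ n) (S : Finset (ℕ × ℕ))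
    (h : ∀ e ∈ S, e.1 + 1 < e.2 ∧ e.2 < n)
    (hnc : ∀ e ∈ S, ∀ f ∈ S, ¬ (e.1 < f.1 ∧ f.1 < e.2 ∧ e.2 < f.2))
    (h0 : (0, n - 1) ∉ S) :
    S.card ≤ n - 3 := by
  classical
  have := comb_page n (insert (0, n - 1) S) ?_ ?_
  · rw [Finset.card_insert_of_notMem h0] at this
    omega
  · intro e he
    rcases Finset.mem_insert.1 he with rfl | he
    · simp; omega
    · exact h e he
  · intro e he f hf
    rcases Finset.mem_insert.1 he with rfl | he <;> rcases Finset.mem_insert.1 hf with rfl | hf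
    · simp
    · have := h f hf
      simp; omega
    · have := h e he
      simp
    · exact hnc e he f hf

lemma comb_bound (n : ℕ) (hn : 3 ≤ n) (F : Finset (ℕ × ℕ)) (up : ℕ × ℕ → Prop)
    (h : ∀ e ∈ F, e.1 < e.2 ∧ e.2 < n)
    (hnc : ∀ e ∈ F, ∀ f ∈ F, e.1 + 1 < e.2 → f.1 + 1 < f.2 → (up e ↔ up f) →
      ¬ (e.1 < f.1 ∧ f.1 < e.2 ∧ e.2 < f.2)) :
    F.card ≤ 3 * n - 6 := by
  classical
  let C := F.filter (fun e => e.2 = e.1 + 1)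
  let U := F.filter (fun e => e.1 + 1 < e.2 ∧ up e)
  let L := F.filter (fun e => e.1 + 1 < e.2 ∧ ¬ up e)
  have hF : F ⊆ C ∪ (U ∪ L) := by
    intro e he
    have := h e he
    simp only [C, U, L, Finset.mem_union, Finset.mem_filter, he, true_and]
    by_cases h1 : e.2 = e.1 + 1
    · exact Or.inl h1
    · have : e.1 + 1 < e.2 := by omega
      tauto
  have hC : C.card ≤ n - 1 := by
    have : C ⊆ (Finset.range (n - 1)).image (fun i => (i, i + 1)) := by
      intro e he
      simp only [C, Finset.mem_filter] at he
      have := h e he.1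
      simp only [Finset.mem_image, Finset.mem_range]
      exact ⟨e.1, by omega, Prod.ext rfl he.2.symm⟩
    calc C.card ≤ _ := Finset.card_le_card this
      _ ≤ (Finset.range (n - 1)).card := Finset.card_image_le
      _ = n - 1 := by simp
  have hU1 : ∀ e ∈ U, e.1 + 1 < e.2 ∧ e.2 < n := by
    intro e he
    simp only [U, Finset.mem_filter] at he
    exact ⟨he.2.1, (h e he.1).2⟩
  have hL1 : ∀ e ∈ L, e.1 + 1 < e.2 ∧ e.2 < n := by
    intro e he
    simp only [L, Finset.mem_filter] at he
    exact ⟨he.2.1, (h e he.1).2⟩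
  have hU2 : ∀ e ∈ U, ∀ f ∈ U, ¬ (e.1 < f.1 ∧ f.1 < e.2 ∧ e.2 < f.2) := by
    intro e he f hf
    simp only [U, Finset.mem_filter] at he hf
    exact hnc e he.1 f hf.1 he.2.1 hf.2.1 (by tauto)
  have hL2 : ∀ e ∈ L, ∀ f ∈ L, ¬ (e.1 < f.1 ∧ f.1 < e.2 ∧ e.2 < f.2) := by
    intro e he f hf
    simp only [L, Finset.mem_filter] at he hf
    exact hnc e he.1 f hf.1 he.2.1 hf.2.1 (by tauto)
  have hcard : F.card ≤ C.card + (U.card + L.card) :=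
    (Finset.card_le_card hF).trans ((Finset.card_union_le _ _).trans
      (Nat.add_le_add_left (Finset.card_union_le _ _) _))
  have u1 := comb_page n U hU1 hU2
  have l1 := comb_page n L hL1 hL2
  by_cases h0 : (0, n - 1) ∈ U
  · have h0' : (0, n - 1) ∉ L := by
      simp only [U, L, Finset.mem_filter] at h0 ⊢
      tauto
    have := comb_page' n hn L hL1 hL2 h0'
    omega
  · have := comb_page' n hn U hU1 hU2 h0
    omega

/-! ### Polylines in coordinates -/

/-- `(x,y)` lies on the polyline `(p,0), (u,w), (q,0)`. -/
def OnPoly (p q u w x y : ℝ) : Prop :=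
  ∃ t : ℝ, 0 ≤ t ∧ t ≤ 1 ∧
    ((x = p + t * (u - p) ∧ y = t * w) ∨ (x = q + t * (u - q) ∧ y = t * w))

lemma onPoly_neg {p q u w x y : ℝ} (h : OnPoly p q u w x y) :
    OnPoly p q u (-w) x (-y) := by
  obtain ⟨t, h0, h1, h | h⟩ := h
  · exact ⟨t, h0, h1, Or.inl ⟨h.1, by rw [h.2]; ring⟩⟩
  · exact ⟨t, h0, h1, Or.inr ⟨h.1, by rw [h.2]; ring⟩⟩

lemma onPoly_of_left {a c u w x y : ℝ} (hac : a < c) (hw : 0 < w) (hy : 0 < y)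
    (h1 : (x - a) * w - (u - a) * y = 0) (h2 : 0 ≤ (c - x) * w + (u - c) * y) :
    OnPoly a c u w x y := by
  refine ⟨y / w, by positivity, ?_, Or.inl ⟨?_, ?_⟩⟩
  · rw [div_le_one hw]
    have : 0 ≤ (c - a) * (w - y) := by nlinarith
    have := nonneg_of_mul_nonneg_right this (by linarith)
    linarith
  · field_simp
    linarith
  · field_simp

lemma onPoly_of_right {a c u w x y : ℝ} (hac : a < c) (hw : 0 < w) (hy : 0 < y)
    (h1 : 0 ≤ (x - a) * w - (u - a) * y) (h2 : (c - x) * w + (u - c) * y = 0) :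
    OnPoly a c u w x y := by
  refine ⟨y / w, by positivity, ?_, Or.inr ⟨?_, ?_⟩⟩
  · rw [div_le_one hw]
    have : 0 ≤ (c - a) * (w - y) := by nlinarith
    have := nonneg_of_mul_nonneg_right this (by linarith)
    linarith
  · field_simp
    linarith
  · field_simp

lemma cross_pos {a c a' c' u w u' w' : ℝ} (h1 : a < a') (h2 : a' < c) (h3 : c < c')
    (hw : 0 < w) (hw' : 0 < w') :
    ∃ x y, 0 < y ∧ OnPoly a c u w x y ∧ OnPoly a' c' u' w' x y := by
  let f : ℝ → ℝ → ℝ := fun x y =>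
    min ((x - a) * w - (u - a) * y) ((c - x) * w + (u - c) * y)
  have hfin : ∀ x y, 0 < y → f x y = 0 → OnPoly a c u w x y := by
    intro x y hy hf
    rcases min_choice ((x - a) * w - (u - a) * y) ((c - x) * w + (u - c) * y) with h | h
    · have e1 : (x - a) * w - (u - a) * y = 0 := h.symm.trans hf
      have e2 := min_le_right ((x - a) * w - (u - a) * y) ((c - x) * w + (u - c) * y)
      exact onPoly_of_left (by linarith) hw hy e1 (by linarith)
    · have e1 : (c - x) * w + (u - c) * y = 0 := h.symm.trans hf
      have e2 := min_le_left ((x - a) * w - (u - a) * y) ((c - x) * w + (u - c) * y)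
      exact onPoly_of_right (by linarith) hw hy (by linarith) e1
  have hfa : 0 < f a' 0 := by
    simp only [f, lt_min_iff]
    constructor
    · have : 0 < (a' - a) * w := mul_pos (by linarith) hw
      linarith
    · have : 0 < (c - a') * w := mul_pos (by linarith) hw
      linarith
  have hfc : f c' 0 < 0 := by
    simp only [f, min_lt_iff]
    right
    have : 0 < (c' - c) * w := mul_pos (by linarith) hw
    nlinarith
  have hcont : ∀ q : ℝ, Continuous (fun t : ℝ => f (q + t * (u' - q)) (t * w')) := by
    intro q
    simp only [f]
    fun_prop
  rcases le_or_gt (f u' w') 0 with hb | hb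
  · have := intermediate_value_Icc' (zero_le_one' ℝ) (hcont a').continuousOn
    obtain ⟨t, ht, hft⟩ := this (show (0 : ℝ) ∈ _ by
      simp only [Set.mem_Icc, one_mul, zero_mul, add_zero]
      exact ⟨by simpa using hb, hfa.le⟩)
    have ht0 : 0 < t := by
      rcases ht.1.lt_or_eq with h | h
      · exact h
      · subst h
        simp only [zero_mul, add_zero] at hft
        linarith
    have hy : 0 < t * w' := mul_pos ht0 hw'
    exact ⟨_, _, hy, hfin _ _ hy hft, t, ht.1, ht.2, Or.inl ⟨rfl, rfl⟩⟩
  · have := intermediate_value_Icc (zero_le_one' ℝ) (hcont c').continuousOn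
    obtain ⟨t, ht, hft⟩ := this (show (0 : ℝ) ∈ _ by
      simp only [Set.mem_Icc, one_mul, zero_mul, add_zero]
      exact ⟨hfc.le, by simpa using hb.le⟩)
    have ht0 : 0 < t := by
      rcases ht.1.lt_or_eq with h | h
      · exact h
      · subst h
        simp only [zero_mul, add_zero] at hft
        linarith
    have hy : 0 < t * w' := mul_pos ht0 hw'
    exact ⟨_, _, hy, hfin _ _ hy hft, t, ht.1, ht.2, Or.inr ⟨rfl, rfl⟩⟩

lemma cross_any {a c a' c' u w u' w' : ℝ} (h1 : a < a') (h2 : a' < c) (h3 : c < c')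
    (hw : w ≠ 0) (hw' : w' ≠ 0) (hs : 0 < w ↔ 0 < w') :
    ∃ x y, y ≠ 0 ∧ OnPoly a c u w x y ∧ OnPoly a' c' u' w' x y := by
  rcases lt_or_gt_of_ne hw with h | h
  · have h' : w' < 0 := by
      rcases lt_or_gt_of_ne hw' with h' | h'
      · exact h'
      · have := hs.2 h'
        linarith
    obtain ⟨x, y, hy, p1, p2⟩ := cross_pos (u := u) (u' := u') h1 h2 h3
      (neg_pos.2 h) (neg_pos.2 h')
    refine ⟨x, -y, by linarith [hy] |> fun h : -y < 0 => h.ne, ?_, ?_⟩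
    · simpa using onPoly_neg p1
    · simpa using onPoly_neg p2
  · obtain ⟨x, y, hy, p1, p2⟩ := cross_pos (u := u) (u' := u') h1 h2 h3 h (hs.1 h)
    exact ⟨x, y, hy.ne', p1, p2⟩

lemma onPoly_endpoint {p q u w x : ℝ} (hw : w ≠ 0) (h : OnPoly p q u w x 0) :
    x = p ∨ x = q := by
  obtain ⟨t, h0, h1, h | h⟩ := h
  · have ht : t = 0 := by
      rcases mul_eq_zero.1 h.2.symm with h | h
      · exact h
      · exact absurd h hw
    left; rw [h.1, ht]; ring
  · have ht : t = 0 := by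
      rcases mul_eq_zero.1 h.2.symm with h | h
      · exact h
      · exact absurd h hw
    right; rw [h.1, ht]; ring

lemma onPoly_degenerate {p q u x : ℝ} (h1 : p < x) (h2 : x < q) : OnPoly p q u 0 x 0 := by
  rcases le_or_gt x u with h | h
  · have : 0 < u - p := by linarith
    refine ⟨(x - p) / (u - p), div_nonneg (by linarith) this.le, ?_, Or.inl ⟨?_, by simp⟩⟩
    · rw [div_le_one this]; linarith
    · field_simp; ring
  · have : 0 < q - u := by linarith
    refine ⟨(q - x) / (q - u), div_nonneg (by linarith) this.le, ?_, Or.inr ⟨?_, by simp⟩⟩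
    · rw [div_le_one this]; linarith
    · field_simp; ring

lemma onPoly_nonneg {p q u w x y : ℝ} (hw : 0 < w) (h : OnPoly p q u w x y) : 0 ≤ y := by
  obtain ⟨t, h0, h1, h | h⟩ := h <;> rw [h.2] <;> positivity

/-- Inner polyline `I = (p,q,u,w)` with bend strictly inside the triangle of `K`. -/
lemma sep_inside {p q u w p' q' u' w' x y : ℝ} (hpq : p < q)
    (hp : p' ≤ p) (hq : q ≤ q')
    (hw : 0 < w) (hw' : 0 < w')
    (hA : 0 < (u - p') * w' - (u' - p') * w) (hB : 0 < (q' - u) * w' + (u' - q') * w)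
    (hI : OnPoly p q u w x y) (hK : OnPoly p' q' u' w' x y) : y = 0 := by
  have hy0 := onPoly_nonneg hw hI
  by_contra hne
  have hy : 0 < y := lt_of_le_of_ne hy0 (Ne.symm hne)
  have hin : 0 < (x - p') * w' - (u' - p') * y ∧ 0 < (q' - x) * w' + (u' - q') * y := by
    obtain ⟨t, h0, h1, ⟨hx, hyt⟩ | ⟨hx, hyt⟩⟩ := hI
    all_goals
      have ht : 0 < t := by
        by_contra hcon
        have : t = 0 := by linarith
        rw [this] at hyt
        linarith
      have e1 : 0 ≤ (1 - t) * ((p - p') * w') :=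
        mul_nonneg (by linarith) (mul_nonneg (by linarith) hw'.le)
      have e2 : 0 ≤ (1 - t) * ((q' - p) * w') :=
        mul_nonneg (by linarith) (mul_nonneg (by linarith) hw'.le)
      have e3 : 0 ≤ (1 - t) * ((q - p') * w') :=
        mul_nonneg (by linarith) (mul_nonneg (by linarith) hw'.le)
      have e4 : 0 ≤ (1 - t) * ((q' - q) * w') :=
        mul_nonneg (by linarith) (mul_nonneg (by linarith) hw'.le)
      have e5 := mul_pos ht hA
      have e6 := mul_pos ht hB
      rw [hx, hyt]
      constructor <;> linarith
  obtain ⟨t, h0, h1, ⟨hx, hyt⟩ | ⟨hx, hyt⟩⟩ := hK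
  · have := hin.1
    rw [hx, hyt] at this
    linarith
  · have := hin.2
    rw [hx, hyt] at this
    linarith

lemma sep_disjoint {p q u w p' q' u' w' x y : ℝ} (hpq : p < q) (hpq' : p' < q')
    (hqp : q ≤ p') (hw : 0 < w) (hw' : 0 < w')
    (hB : (q - u') * w + (u - q) * w' < 0)
    (hI : OnPoly p q u w x y) (hK : OnPoly p' q' u' w' x y) : y = 0 := by
  have hy0 := onPoly_nonneg hw hI
  by_contra hne
  have hy : 0 < y := lt_of_le_of_ne hy0 (Ne.symm hne)
  have h1 : (q - x) * w + (u - q) * y < 0 := by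
    obtain ⟨t, h0, h1, ⟨hx, hyt⟩ | ⟨hx, hyt⟩⟩ := hK
    all_goals
      have ht : 0 < t := by
        by_contra hcon
        have : t = 0 := by linarith
        rw [this] at hyt
        linarith
      have e1 : 0 ≤ (1 - t) * ((p' - q) * w) :=
        mul_nonneg (by linarith) (mul_nonneg (by linarith) hw.le)
      have e2 : 0 ≤ (1 - t) * ((q' - q) * w) :=
        mul_nonneg (by linarith) (mul_nonneg (by linarith) hw.le)
      have e5 := mul_pos ht (neg_pos.2 hB)
      rw [hx, hyt]
      linarith
  obtain ⟨t, h0, h2, ⟨hx, hyt⟩ | ⟨hx, hyt⟩⟩ := hI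
  · rw [hx, hyt] at h1
    have e1 : 0 ≤ (1 - t) * ((q - p) * w) :=
      mul_nonneg (by linarith) (mul_nonneg (by linarith) hw.le)
    linarith
  · rw [hx, hyt] at h1
    linarith

/-! ### Frames -/

/-- The point with coordinates `(x,y)` in the frame with origin `o` and first axis `(c,s)`. -/
def Phi (o : Pt) (c s x y : ℝ) : Pt := !₂[o 0 + x * c - y * s, o 1 + x * s + y * c]

lemma Phi_surj (o : Pt) {c s : ℝ} (h : c ^ 2 + s ^ 2 = 1) (p : Pt) :
    ∃ x y, p = Phi o c s x y := by
  refine ⟨(p 0 - o 0) * c + (p 1 - o 1) * s, -(p 0 - o 0) * s + (p 1 - o 1) * c, ?_⟩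
  ext i
  fin_cases i
  · simp [Phi]
    linear_combination (-(p 0 - o 0)) * h
  · simp [Phi]
    linear_combination (-(p 1 - o 1)) * h

lemma Phi_inj (o : Pt) {c s x y x' y' : ℝ} (h : c ^ 2 + s ^ 2 = 1)
    (he : Phi o c s x y = Phi o c s x' y') : x = x' ∧ y = y' := by
  have h0 := congrArg (fun p : Pt => p 0) he
  have h1 := congrArg (fun p : Pt => p 1) he
  simp [Phi] at h0 h1
  constructor
  · linear_combination c * h0 + s * h1 - (x - x') * h
  · linear_combination (-s) * h0 + c * h1 - (y - y') * h

lemma Phi_lin (o : Pt) (c s x y x' y' t : ℝ) :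
    (1 - t) • Phi o c s x y + t • Phi o c s x' y' =
      Phi o c s (x + t * (x' - x)) (y + t * (y' - y)) := by
  ext i
  fin_cases i
  · simp [Phi]; ring
  · simp [Phi]; ring

lemma bendImage_iff (o : Pt) {c s : ℝ} (h : c ^ 2 + s ^ 2 = 1) (p q u w x y : ℝ) :
    Phi o c s x y ∈ bendImage (Phi o c s p 0, Phi o c s u w, Phi o c s q 0) ↔
      OnPoly p q u w x y := by
  unfold bendImage OnPoly
  rw [segment_symm ℝ (Phi o c s u w)]
  simp only [Set.mem_union, segment_eq_image, Set.mem_image, Phi_lin]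
  constructor
  · rintro (⟨t, ht, he⟩ | ⟨t, ht, he⟩)
    · obtain ⟨h1, h2⟩ := Phi_inj o h he
      exact ⟨t, ht.1, ht.2, Or.inl ⟨h1.symm, by rw [← h2]; ring⟩⟩
    · obtain ⟨h1, h2⟩ := Phi_inj o h he
      exact ⟨t, ht.1, ht.2, Or.inr ⟨h1.symm, by rw [← h2]; ring⟩⟩
  · rintro ⟨t, h0, h1, ⟨h2, h3⟩ | ⟨h2, h3⟩⟩
    · exact Or.inl ⟨t, ⟨h0, h1⟩, by rw [h2, h3]; simp⟩
    · exact Or.inr ⟨t, ⟨h0, h1⟩, by rw [h2, h3]; simp⟩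

lemma bendImage_swap (a b c : Pt) : bendImage (a, b, c) = bendImage (c, b, a) := by
  unfold bendImage
  simp only
  rw [segment_symm ℝ a b, segment_symm ℝ b c, Set.union_comm]

lemma exists_frame (P : Finset Pt) (hcard : 3 ≤ P.card) (hcol : Collinear ℝ (P : Set Pt)) :
    ∃ (o : Pt) (c s : ℝ) (x : ℕ → ℝ), c ^ 2 + s ^ 2 = 1 ∧
      (∀ i j, i < j → j < P.card → x i < x j) ∧
      (∀ p, p ∈ P ↔ ∃ i < P.card, p = Phi o c s (x i) 0) := by
  classical
  obtain ⟨o, ho⟩ : P.Nonempty := Finset.card_pos.1 (by omega)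
  obtain ⟨v, hv⟩ := (collinear_iff_of_mem (k := ℝ) (p₀ := o) ho).1 hcol
  have hv0 : v ≠ 0 := by
    rintro rfl
    have : P ⊆ {o} := by
      intro p hp
      obtain ⟨r, hr⟩ := hv p hp
      simpa using hr
    have := Finset.card_le_card this
    simp at this
    omega
  have hn : 0 < ‖v‖ := norm_pos_iff.2 hv0
  have hnsq : ‖v‖ ^ 2 = v 0 ^ 2 + v 1 ^ 2 := by
    rw [EuclideanSpace.norm_sq_eq]
    simp [Fin.sum_univ_two]
  have hcs : (v 0 / ‖v‖) ^ 2 + (v 1 / ‖v‖) ^ 2 = 1 := by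
    field_simp
    linarith
  set c := v 0 / ‖v‖ with hc
  set s := v 1 / ‖v‖ with hs
  have hP : ∀ p ∈ P, ∃ r : ℝ, p = Phi o c s r 0 := by
    intro p hp
    obtain ⟨r, hr⟩ := hv p hp
    refine ⟨r * ‖v‖, ?_⟩
    rw [hr]
    ext i
    fin_cases i
    · simp [Phi, hc]; field_simp; ring
    · simp [Phi, hs]; field_simp; ring
  choose! X hX using hP
  have hXinj : Set.InjOn X (P : Set Pt) := by
    intro p hp q hq hpq
    rw [hX p hp, hX q hq, hpq]
  have hcardX : (P.image X).card = P.card := Finset.card_image_of_injOn hXinj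
  let g := (P.image X).orderEmbOfFin hcardX
  refine ⟨o, c, s, fun i => if h : i < P.card then g ⟨i, h⟩ else 0, hcs, ?_, ?_⟩
  · intro i j hij hj
    have hi : i < P.card := hij.trans hj
    simp only [hi, hj, dif_pos]
    exact g.strictMono hij
  · intro p
    constructor
    · intro hp
      have : X p ∈ Set.range g := by
        rw [Finset.range_orderEmbOfFin]
        exact Finset.mem_coe.2 (Finset.mem_image_of_mem _ hp)
      obtain ⟨i, hi⟩ := this
      refine ⟨i, i.2, ?_⟩
      simp only [i.2, dif_pos]
      rw [hi]
      exact hX p hp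
    · rintro ⟨i, hi, rfl⟩
      simp only [hi, dif_pos]
      have : g ⟨i, hi⟩ ∈ P.image X := Finset.orderEmbOfFin_mem _ _ _
      obtain ⟨q, hq, hqe⟩ := Finset.mem_image.1 this
      rw [← hqe, ← hX q hq]
      exact hq

/-! ### Upper bound -/

lemma upper_bound (α : ℝ) (P : Finset Pt)
    (hcard : 3 ≤ P.card) (hcol : Collinear ℝ (P : Set Pt))
    (E : Finset (Pt × Pt × Pt)) (hE : IsPlaneBendGraph α P E) :
    E.card ≤ 3 * P.card - 6 := by
  classical
  obtain ⟨o, c, s, x, hcs, hx, hP⟩ := exists_frame P hcard hcol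
  obtain ⟨⟨h1, -, h3, h4⟩, h5⟩ := hE
  have hdata : ∀ e ∈ E, ∃ (k : ℕ × ℕ) (u w : ℝ), k.1 < k.2 ∧ k.2 < P.card ∧
      edgeEndpoints e = {Phi o c s (x k.1) 0, Phi o c s (x k.2) 0} ∧
      bendImage e = bendImage (Phi o c s (x k.1) 0, Phi o c s u w, Phi o c s (x k.2) 0) := by
    rintro ⟨a, b, d⟩ he
    obtain ⟨⟨hne, -⟩, ha, hd⟩ := h1 _ he
    simp only at hne ha hd
    obtain ⟨i, hi, rfl⟩ := (hP a).1 ha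
    obtain ⟨j, hj, rfl⟩ := (hP d).1 hd
    obtain ⟨u, w, rfl⟩ := Phi_surj o hcs b
    have hij : i ≠ j := by
      rintro rfl
      exact hne rfl
    rcases lt_or_gt_of_ne hij with h | h
    · exact ⟨(i, j), u, w, h, hj, rfl, rfl⟩
    · exact ⟨(j, i), u, w, h, hi, by simp [edgeEndpoints, Set.pair_comm], bendImage_swap _ _ _⟩
  choose! k u w hk1 hk2 hk3 hk4 using hdata
  have hinj : Set.InjOn k (E : Set (Pt × Pt × Pt)) := by
    intro e he f hf hef
    by_contra hne
    apply h5 e he f hf hne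
    rw [hk3 e he, hk3 f hf, hef]
  have hdeg : ∀ e ∈ E, (k e).1 + 1 < (k e).2 → w e ≠ 0 := by
    intro e he hlt hw
    have hb := hk2 e he
    have i1 := hx _ _ (Nat.lt_succ_self (k e).1) (by simp; omega)
    have i2 := hx _ _ hlt hb
    have hm := h3 e he (Phi o c s (x ((k e).1 + 1)) 0) ((hP _).2 ⟨_, by omega, rfl⟩) (by
      rw [hk4 e he, bendImage_iff o hcs, hw]
      exact onPoly_degenerate i1 i2)
    rw [hk3 e he] at hm
    rcases hm with hm | hm
    · have := (Phi_inj o hcs hm).1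
      simp at i1
      linarith
    · have := (Phi_inj o hcs hm).1
      linarith
  rw [← Finset.card_image_of_injOn hinj]
  apply comb_bound P.card hcard (E.image k) (fun m => ∃ e ∈ E, k e = m ∧ 0 < w e)
  · intro m hm
    obtain ⟨e, he, rfl⟩ := Finset.mem_image.1 hm
    exact ⟨hk1 e he, hk2 e he⟩
  · intro m hm m' hm' l1 l2 hup ⟨q1, q2, q3⟩
    obtain ⟨e, he, rfl⟩ := Finset.mem_image.1 hm
    obtain ⟨f, hf, rfl⟩ := Finset.mem_image.1 hm'
    have key : ∀ e ∈ E, (∃ e' ∈ E, k e' = k e ∧ 0 < w e') ↔ 0 < w e := by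
      intro e he
      constructor
      · rintro ⟨e', he', hke, hw⟩
        rw [← hinj he' he hke]
        exact hw
      · intro hw
        exact ⟨e, he, rfl, hw⟩
    simp only [key e he, key f hf] at hup
    have be := hk2 e he
    have bf := hk2 f hf
    obtain ⟨X, Y, hY, p1, p2⟩ := cross_any (u := u e) (u' := u f) (hx _ _ q1 (by omega))
      (hx _ _ q2 (by omega)) (hx _ _ q3 (by omega)) (hdeg e he l1) (hdeg f hf l2) hup
    have hef : e ≠ f := by
      rintro rfl
      omega
    have := h4 e he f hf hef ⟨by rw [hk4 e he, bendImage_iff o hcs]; exact p1,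
      by rw [hk4 f hf, bendImage_iff o hcs]; exact p2⟩
    have := this.1
    rw [hk3 e he] at this
    rcases this with h | h
    · exact hY (Phi_inj o hcs h).2
    · exact hY (Phi_inj o hcs h).2

/-! ### Construction -/

/-- The left angle of the bend drawn over `[p,q]`. -/
def th (α δ p q : ℝ) : ℝ := (π - α) / 2 + δ * (p + q)

/-- Length of the left leg. -/
def legL (α δ p q : ℝ) : ℝ := (q - p) * sin (α + th α δ p q) / sin α

/-- Length of the right leg. -/
def legR (α δ p q : ℝ) : ℝ := (q - p) * sin (th α δ p q) / sin α

/-- First coordinate of the bend. -/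
def bu (α δ p q : ℝ) : ℝ := p + legL α δ p q * cos (th α δ p q)

/-- Second coordinate of the bend. -/
def bw (α δ p q : ℝ) : ℝ := legL α δ p q * sin (th α δ p q)

lemma bu_right {α δ p q : ℝ} (hα : sin α ≠ 0) :
    bu α δ p q = q + legR α δ p q * cos (α + th α δ p q) := by
  have h : sin α = sin (α + th α δ p q) * cos (th α δ p q) -
      cos (α + th α δ p q) * sin (th α δ p q) := by
    rw [← sin_sub]; congr 1; ring
  unfold bu legL legR
  generalize sin (α + th α δ p q) = A at *
  generalize cos (α + th α δ p q) = B at *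
  field_simp
  linear_combination (p - q) * h

lemma bw_right {α δ p q : ℝ} :
    bw α δ p q = legR α δ p q * sin (α + th α δ p q) := by
  unfold bw legL legR
  ring

/-- The conditions on `δ` used for the intervals `[p,q]` and `[p',q']`. -/
def Good (α δ p q p' q' : ℝ) : Prop :=
  (0 < th α δ p q ∧ α + th α δ p q < π) ∧ (0 < th α δ p' q' ∧ α + th α δ p' q' < π) ∧
  th α δ p' q' < α + th α δ p q ∧
  (p' ≤ p → q ≤ q' → (p' < p ∨ q < q') →
    0 < sin (th α δ p' q') * (p - p') + legL α δ p q * sin (th α δ p' q' - th α δ p q) ∧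
    0 < sin (α + th α δ p' q') * (q' - q) + legR α δ p q * sin (th α δ p q - th α δ p' q'))

open Filter Topology in
lemma eventually_good {α p q p' q' : ℝ} (hα : α ∈ Set.Ioo 0 π) (hpq : p < q) :
    ∀ᶠ δ in 𝓝[>] (0 : ℝ), Good α δ p q p' q' := by
  obtain ⟨hα0, hα1⟩ := hα
  have hs : 0 < sin α := sin_pos_of_pos_of_lt_pi hα0 hα1
  have c1 : ∀ p q : ℝ, Continuous (fun δ => th α δ p q) := by
    intro p q; unfold th; fun_prop
  have c2 : ∀ p q : ℝ, Continuous (fun δ => legL α δ p q) := by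
    intro p q; unfold legL
    have := c1 p q
    fun_prop
  have c3 : ∀ p q : ℝ, Continuous (fun δ => legR α δ p q) := by
    intro p q; unfold legR
    have := c1 p q
    fun_prop
  have t0 : ∀ p q, th α 0 p q = (π - α) / 2 := by
    intro p q; unfold th; ring
  have pos : ∀ f : ℝ → ℝ, Continuous f → 0 < f 0 → ∀ᶠ δ in 𝓝[>] (0 : ℝ), 0 < f δ := by
    intro f hf h0
    exact (hf.continuousAt.eventually (lt_mem_nhds h0)).filter_mono nhdsWithin_le_nhds
  have d1 := c1 p q
  have d1' := c1 p' q'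
  have d2 := c2 p q
  have d3 := c3 p q
  have e1 := pos (fun δ => th α δ p q) (c1 p q) (by simp only [t0]; linarith)
  have e2 := pos (fun δ => π - (α + th α δ p q)) (by fun_prop) (by simp only [t0]; linarith)
  have e3 := pos (fun δ => th α δ p' q') (c1 p' q') (by simp only [t0]; linarith)
  have e4 := pos (fun δ => π - (α + th α δ p' q')) (by fun_prop) (by simp only [t0]; linarith)
  have e5 := pos (fun δ => α + th α δ p q - th α δ p' q') (by fun_prop)
    (by simp only [t0]; linarith)
  have s0 : 0 < sin ((π - α) / 2) := sin_pos_of_pos_of_lt_pi (by linarith) (by linarith)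
  have s1 : 0 < sin (α + (π - α) / 2) := sin_pos_of_pos_of_lt_pi (by linarith) (by linarith)
  have e0 : ∀ᶠ δ in 𝓝[>] (0 : ℝ), 0 < δ := self_mem_nhdsWithin
  have hA : ∀ᶠ δ in 𝓝[>] (0 : ℝ), p' ≤ p → q ≤ q' → (p' < p ∨ q < q') →
      0 < sin (th α δ p' q') * (p - p') + legL α δ p q * sin (th α δ p' q' - th α δ p q) := by
    by_cases hp : p' < p
    · have := pos (fun δ => sin (th α δ p' q') * (p - p') +
        legL α δ p q * sin (th α δ p' q' - th α δ p q)) (by fun_prop) (by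
          simp only [t0, sub_self, sin_zero, mul_zero, add_zero]
          exact mul_pos s0 (by linarith))
      filter_upwards [this] with δ h _ _ _
      exact h
    · filter_upwards [e0, e1, e2, e3, e4] with δ e0 e1 e2 e3 e4 i1 i2 i3
      have hpp : p' = p := le_antisymm i1 (not_lt.1 hp)
      subst hpp
      have hq : q < q' := by
        rcases i3 with h | h
        · exact absurd h hp
        · exact h
      have hd : 0 < th α δ p' q' - th α δ p' q := by
        unfold th
        have := mul_pos e0 (sub_pos.2 hq)
        linarith
      have hl : 0 < legL α δ p' q := by
        unfold legL
        exact div_pos (mul_pos (by linarith)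
          (sin_pos_of_pos_of_lt_pi (by linarith) (by linarith))) hs
      have := mul_pos hl (sin_pos_of_pos_of_lt_pi hd (by linarith))
      simpa using this
  have hB : ∀ᶠ δ in 𝓝[>] (0 : ℝ), p' ≤ p → q ≤ q' → (p' < p ∨ q < q') →
      0 < sin (α + th α δ p' q') * (q' - q) +
        legR α δ p q * sin (th α δ p q - th α δ p' q') := by
    by_cases hq : q < q'
    · have := pos (fun δ => sin (α + th α δ p' q') * (q' - q) +
        legR α δ p q * sin (th α δ p q - th α δ p' q')) (by fun_prop) (by
          simp only [t0, sub_self, sin_zero, mul_zero, add_zero]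
          exact mul_pos s1 (by linarith))
      filter_upwards [this] with δ h _ _ _
      exact h
    · filter_upwards [e0, e1, e2, e3, e4] with δ e0 e1 e2 e3 e4 i1 i2 i3
      have hqq : q = q' := le_antisymm i2 (not_lt.1 hq)
      subst hqq
      have hp : p' < p := by
        rcases i3 with h | h
        · exact h
        · exact absurd h hq
      have hd : 0 < th α δ p q - th α δ p' q := by
        unfold th
        have := mul_pos e0 (sub_pos.2 hp)
        linarith
      have hl : 0 < legR α δ p q := by
        unfold legR
        exact div_pos (mul_pos (by linarith)
          (sin_pos_of_pos_of_lt_pi (by linarith) (by linarith))) hs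
      have := mul_pos hl (sin_pos_of_pos_of_lt_pi hd (by linarith))
      simpa using this
  filter_upwards [e1, e2, e3, e4, e5, hA, hB] with δ e1 e2 e3 e4 e5 hA hB
  exact ⟨⟨e1, by linarith⟩, ⟨e3, by linarith⟩, by linarith,
    fun a b c => ⟨hA a b c, hB a b c⟩⟩

open Filter Topology in
lemma exists_delta {α : ℝ} (hα : α ∈ Set.Ioo 0 π) (n : ℕ) (x : ℕ → ℝ)
    (hx : ∀ i j, i < j → j < n → x i < x j) :
    ∃ δ : ℝ, ∀ i j k l, i < j → j < n → k < l → l < n →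
      Good α δ (x i) (x j) (x k) (x l) := by
  have : ∀ᶠ δ in 𝓝[>] (0 : ℝ), ∀ i ∈ Finset.range n, ∀ j ∈ Finset.range n,
      ∀ k ∈ Finset.range n, ∀ l ∈ Finset.range n,
      i < j → Good α δ (x i) (x j) (x k) (x l) := by
    simp only [Filter.eventually_all_finset]
    intro i _ j hj k _ l _
    by_cases hij : i < j
    · filter_upwards [eventually_good (p' := x k) (q' := x l) hα
        (hx i j hij (Finset.mem_range.1 hj))] with δ h _
      exact h
    · exact Filter.Eventually.of_forall fun δ h => absurd h hij
  obtain ⟨δ, h⟩ := this.exists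
  refine ⟨δ, fun i j k l hij hj hkl hl => ?_⟩
  exact h i (Finset.mem_range.2 (by omega)) j (Finset.mem_range.2 hj) k
    (Finset.mem_range.2 (by omega)) l (Finset.mem_range.2 hl) hij

lemma leg_pos {α δ p q : ℝ} (hα : α ∈ Set.Ioo 0 π) (hpq : p < q)
    (h : 0 < th α δ p q ∧ α + th α δ p q < π) :
    0 < legL α δ p q ∧ 0 < legR α δ p q ∧ 0 < bw α δ p q := by
  obtain ⟨hα0, hα1⟩ := hα
  have hs : 0 < sin α := sin_pos_of_pos_of_lt_pi hα0 hα1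
  have s0 : 0 < sin (th α δ p q) := sin_pos_of_pos_of_lt_pi (by linarith) (by linarith)
  have s1 : 0 < sin (α + th α δ p q) := sin_pos_of_pos_of_lt_pi (by linarith) (by linarith)
  have hl : 0 < legL α δ p q := div_pos (mul_pos (by linarith) s1) hs
  exact ⟨hl, div_pos (mul_pos (by linarith) s0) hs, mul_pos hl s0⟩

lemma good_nested {α δ p q p' q' x y : ℝ} (hα : α ∈ Set.Ioo 0 π) (hpq : p < q)
    (hpq' : p' < q') (hG : Good α δ p q p' q')
    (hp : p' ≤ p) (hq : q ≤ q') (hne : p' < p ∨ q < q')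
    (hI : OnPoly p q (bu α δ p q) (bw α δ p q) x y)
    (hK : OnPoly p' q' (bu α δ p' q') (bw α δ p' q') x y) : y = 0 := by
  obtain ⟨g1, g2, -, g4⟩ := hG
  obtain ⟨hA, hB⟩ := g4 hp hq hne
  obtain ⟨l1, l2, l3⟩ := leg_pos hα hpq g1
  obtain ⟨k1, k2, k3⟩ := leg_pos hα hpq' g2
  have hs : sin α ≠ 0 := (sin_pos_of_pos_of_lt_pi hα.1 hα.2).ne'
  refine sep_inside hpq hp hq l3 k3 ?_ ?_ hI hK
  · have := mul_pos k1 hA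
    rw [sin_sub] at this
    unfold bu bw
    linarith
  · have := mul_pos k2 hB
    have e : th α δ p q - th α δ p' q' = (α + th α δ p q) - (α + th α δ p' q') := by ring
    rw [e, sin_sub] at this
    rw [bu_right hs, bu_right hs, bw_right, bw_right]
    linarith

lemma good_disjoint {α δ p q p' q' x y : ℝ} (hα : α ∈ Set.Ioo 0 π) (hpq : p < q)
    (hpq' : p' < q') (hG : Good α δ p q p' q') (hqp : q ≤ p')
    (hI : OnPoly p q (bu α δ p q) (bw α δ p q) x y)
    (hK : OnPoly p' q' (bu α δ p' q') (bw α δ p' q') x y) : y = 0 := by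
  obtain ⟨g1, g2, g3, -⟩ := hG
  obtain ⟨l1, l2, l3⟩ := leg_pos hα hpq g1
  obtain ⟨k1, k2, k3⟩ := leg_pos hα hpq' g2
  have hs : sin α ≠ 0 := (sin_pos_of_pos_of_lt_pi hα.1 hα.2).ne'
  refine sep_disjoint hpq hpq' hqp l3 k3 ?_ hI hK
  have s1 : 0 < sin (α + th α δ p q) :=
    sin_pos_of_pos_of_lt_pi (by linarith [hα.1]) (by linarith)
  have s2 : 0 < sin (α + th α δ p q - th α δ p' q') :=
    sin_pos_of_pos_of_lt_pi (by linarith) (by linarith)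
  have m1 := mul_pos l2 (mul_pos k1 s2)
  have m2 := mul_nonneg l2.le (mul_nonneg s1.le (sub_nonneg.2 hqp))
  rw [sin_sub] at m1
  rw [bu_right hs (p := p), bw_right (p := p)]
  unfold bu bw
  linarith

lemma bend_angle (o : Pt) {c s α δ p q σ : ℝ} (hcs : c ^ 2 + s ^ 2 = 1) (hσ : σ ^ 2 = 1)
    (hα : α ∈ Set.Ioo 0 π) (hpq : p < q) (h : 0 < th α δ p q ∧ α + th α δ p q < π) :
    ∠ (Phi o c s p 0) (Phi o c s (bu α δ p q) (σ * bw α δ p q)) (Phi o c s q 0) = α := by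
  obtain ⟨l1, l2, -⟩ := leg_pos hα hpq h
  have hs : sin α ≠ 0 := (sin_pos_of_pos_of_lt_pi hα.1 hα.2).ne'
  have e1 : Phi o c s p 0 -ᵥ Phi o c s (bu α δ p q) (σ * bw α δ p q) =
      legL α δ p q • -(Phi 0 c s (cos (th α δ p q)) (σ * sin (th α δ p q))) := by
    unfold bu bw
    ext i
    fin_cases i
    · simp [Phi]; ring
    · simp [Phi]; ring
  have e2 : Phi o c s q 0 -ᵥ Phi o c s (bu α δ p q) (σ * bw α δ p q) =
      legR α δ p q • -(Phi 0 c s (cos (α + th α δ p q)) (σ * sin (α + th α δ p q))) := by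
    rw [bu_right hs, bw_right]
    ext i
    fin_cases i
    · simp [Phi]; ring
    · simp [Phi]; ring
  have nrm : ∀ t : ℝ, ‖Phi 0 c s (cos t) (σ * sin t)‖ = 1 := by
    intro t
    rw [EuclideanSpace.norm_eq, Real.sqrt_eq_one]
    simp [Fin.sum_univ_two, Phi]
    have := sin_sq_add_cos_sq t
    linear_combination (cos t ^ 2 + σ ^ 2 * sin t ^ 2) * hcs + sin t ^ 2 * hσ + this
  unfold EuclideanGeometry.angle
  rw [e1, e2, InnerProductGeometry.angle_smul_left_of_pos _ _ l1,
    InnerProductGeometry.angle_smul_right_of_pos _ _ l2, InnerProductGeometry.angle_neg_neg]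
  unfold InnerProductGeometry.angle
  rw [nrm, nrm]
  have hin : inner ℝ (Phi 0 c s (cos (th α δ p q)) (σ * sin (th α δ p q)))
      (Phi 0 c s (cos (α + th α δ p q)) (σ * sin (α + th α δ p q))) = cos α := by
    have hc : cos α = cos (α + th α δ p q) * cos (th α δ p q) +
        sin (α + th α δ p q) * sin (th α δ p q) := by
      rw [← cos_sub]; congr 1; ring
    rw [hc]
    generalize cos (α + th α δ p q) = A
    generalize sin (α + th α δ p q) = B
    generalize cos (th α δ p q) = C
    generalize sin (th α δ p q) = D
    simp [PiLp.inner_apply, Fin.sum_univ_two, Phi]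
    linear_combination (A * C + σ ^ 2 * B * D) * hcs + B * D * hσ
  rw [hin]
  simp only [mul_one, div_one]
  exact arccos_cos hα.1.le hα.2.le

lemma onPoly_sign {p q u w x y σ : ℝ} (hσ : σ = 1 ∨ σ = -1)
    (h : OnPoly p q u (σ * w) x y) : OnPoly p q u w x (σ * y) := by
  rcases hσ with rfl | rfl
  · simpa using h
  · have := onPoly_neg h
    simpa using this

/-- The index pairs of the extremal graph. -/
def idx (n : ℕ) : Finset (ℕ × ℕ) :=
  (Finset.range (n - 1)).image (fun k => (0, k + 1)) ∪
  ((Finset.range (n - 2)).image (fun k => (k + 1, k + 2)) ∪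
   (Finset.range (n - 3)).image (fun k => (k + 1, n - 1)))

lemma mem_idx {n : ℕ} (hn : 3 ≤ n) {e : ℕ × ℕ} (h : e ∈ idx n) :
    e.1 < e.2 ∧ e.2 < n ∧ (e.1 = 0 ∨ e.2 = e.1 + 1 ∨ e.2 = n - 1) := by
  simp only [idx, Finset.mem_union, Finset.mem_image, Finset.mem_range] at h
  rcases h with ⟨k, hk, rfl⟩ | ⟨k, hk, rfl⟩ | ⟨k, hk, rfl⟩
  · simp; omega
  · simp; omega
  · simp; omega

lemma card_idx {n : ℕ} (hn : 3 ≤ n) : (idx n).card = 3 * n - 6 := by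
  unfold idx
  rw [Finset.card_union_of_disjoint, Finset.card_union_of_disjoint, Finset.card_image_of_injective,
    Finset.card_image_of_injective, Finset.card_image_of_injective]
  · simp; omega
  · intro a b h; simpa using h
  · intro a b h; simpa using h
  · intro a b h; simpa using h
  · rw [Finset.disjoint_left]
    intro e h1 h2
    simp only [Finset.mem_image, Finset.mem_range] at h1 h2
    obtain ⟨k, hk, rfl⟩ := h1
    obtain ⟨l, hl, h⟩ := h2
    simp at h
    omega
  · rw [Finset.disjoint_left]
    intro e h1 h2
    simp only [Finset.mem_union, Finset.mem_image, Finset.mem_range] at h1 h2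
    obtain ⟨k, hk, rfl⟩ := h1
    rcases h2 with ⟨l, hl, h⟩ | ⟨l, hl, h⟩ <;> simp at h

/-- The side on which an edge is drawn. -/
def side (e : ℕ × ℕ) : ℝ := if e.1 = 0 ∨ e.2 = e.1 + 1 then 1 else -1

lemma side_or (e : ℕ × ℕ) : side e = 1 ∨ side e = -1 := by
  unfold side; split_ifs <;> simp

lemma idx_noncross {n : ℕ} (hn : 3 ≤ n) {e f : ℕ × ℕ} (he : e ∈ idx n) (hf : f ∈ idx n)
    (hs : side e = side f) : ¬ (e.1 < f.1 ∧ f.1 < e.2 ∧ e.2 < f.2) := by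
  have h1 := mem_idx hn he
  have h2 := mem_idx hn hf
  unfold side at hs
  split_ifs at hs with h3 h4 h4
  · omega
  · norm_num at hs
  · norm_num at hs
  · omega

lemma lower_bound (α : ℝ) (hα : α ∈ Set.Ioo 0 π) (P : Finset Pt)
    (hcard : 3 ≤ P.card) (hcol : Collinear ℝ (P : Set Pt)) :
    ∃ E : Finset (Pt × Pt × Pt), IsPlaneBendGraph α P E ∧ E.card = 3 * P.card - 6 := by
  classical
  obtain ⟨o, c, s, x, hcs, hx, hP⟩ := exists_frame P hcard hcol
  set n := P.card with hn
  obtain ⟨δ, hδ⟩ := exists_delta hα n x hx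
  have hxinj : ∀ i j, i < n → j < n → x i = x j → i = j := by
    intro i j hi hj h
    rcases lt_trichotomy i j with h' | h' | h'
    · have := hx _ _ h' hj; linarith
    · exact h'
    · have := hx _ _ h' hi; linarith
  have hxle : ∀ i j, i ≤ j → j < n → x i ≤ x j := by
    intro i j h hj
    rcases h.lt_or_eq with h | h
    · exact (hx _ _ h hj).le
    · rw [h]
  let U : ℕ × ℕ → ℝ := fun e => bu α δ (x e.1) (x e.2)
  let W : ℕ × ℕ → ℝ := fun e => bw α δ (x e.1) (x e.2)
  let edge : ℕ × ℕ → Pt × Pt × Pt := fun e =>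
    (Phi o c s (x e.1) 0, Phi o c s (U e) (side e * W e), Phi o c s (x e.2) 0)
  have hW : ∀ e ∈ idx n, 0 < W e := by
    intro e he
    obtain ⟨h1, h2, -⟩ := mem_idx hcard he
    exact (leg_pos hα (hx _ _ h1 h2) (hδ _ _ _ _ h1 h2 h1 h2).1).2.2
  have hside0 : ∀ e, side e ≠ 0 := by
    intro e
    rcases side_or e with h | h <;> rw [h] <;> norm_num
  -- a point of an edge on the axis is an endpoint
  have hend : ∀ e ∈ idx n, ∀ X, Phi o c s X 0 ∈ bendImage (edge e) →
      Phi o c s X 0 ∈ edgeEndpoints (edge e) := by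
    intro e he X hX
    rw [bendImage_iff o hcs] at hX
    rcases onPoly_endpoint (mul_ne_zero (hside0 e) (hW e he).ne') hX with h | h
    · left; simp only [edge]; rw [h]
    · right; simp only [edge]; rw [h]; rfl
  have hsame : ∀ e ∈ idx n, ∀ f ∈ idx n, e ≠ f → side e = side f → e.1 ≤ f.1 → ∀ X Y,
      OnPoly (x e.1) (x e.2) (U e) (W e) X Y → OnPoly (x f.1) (x f.2) (U f) (W f) X Y →
      Y = 0 := by
    intro e he f hf hne hs hle X Y h1 h2
    obtain ⟨a1, a2, -⟩ := mem_idx hcard he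
    obtain ⟨b1, b2, -⟩ := mem_idx hcard hf
    have nc := idx_noncross hcard he hf hs
    by_cases hd : e.2 ≤ f.1
    · exact good_disjoint hα (hx _ _ a1 a2) (hx _ _ b1 b2) (hδ _ _ _ _ a1 a2 b1 b2)
        (hxle _ _ hd (by omega)) h1 h2
    · by_cases hn1 : f.2 ≤ e.2
      · refine good_nested hα (hx _ _ b1 b2) (hx _ _ a1 a2) (hδ _ _ _ _ b1 b2 a1 a2)
          (hxle _ _ hle (by omega)) (hxle _ _ hn1 a2) ?_ h2 h1
        by_cases h11 : e.1 = f.1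
        · right
          apply hx _ _ _ a2
          have : f.2 ≠ e.2 := fun h22 => hne (Prod.ext h11 h22.symm)
          omega
        · left
          exact hx _ _ (by omega) (by omega)
      · have h11 : e.1 = f.1 := by omega
        refine good_nested hα (hx _ _ a1 a2) (hx _ _ b1 b2) (hδ _ _ _ _ a1 a2 b1 b2)
          (by rw [h11]) (hxle _ _ (by omega) b2) (Or.inr (hx _ _ (by omega) b2)) h1 h2
  have hinter : ∀ e ∈ idx n, ∀ f ∈ idx n, e ≠ f →
      bendImage (edge e) ∩ bendImage (edge f) ⊆
        edgeEndpoints (edge e) ∩ edgeEndpoints (edge f) := by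
    rintro e he f hf hne z ⟨hz1, hz2⟩
    obtain ⟨X, Y, rfl⟩ := Phi_surj o hcs z
    have i1 := (bendImage_iff o hcs _ _ _ _ _ _).1 hz1
    have i2 := (bendImage_iff o hcs _ _ _ _ _ _).1 hz2
    have j1 := onPoly_sign (side_or e) i1
    have j2 := onPoly_sign (side_or f) i2
    have hY : Y = 0 := by
      by_cases hs : side e = side f
      · rw [← hs] at j2
        have : side e * Y = 0 := by
          rcases le_total e.1 f.1 with h | h
          · exact hsame e he f hf hne hs h _ _ j1 j2
          · exact hsame f hf e he hne.symm hs.symm h _ _ j2 j1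
        exact (mul_eq_zero.1 this).resolve_left (hside0 e)
      · have p1 := onPoly_nonneg (hW e he) j1
        have p2 := onPoly_nonneg (hW f hf) j2
        rcases side_or e with h1 | h1 <;> rcases side_or f with h2 | h2
        · exact absurd (h1.trans h2.symm) hs
        · rw [h1] at p1; rw [h2] at p2; linarith
        · rw [h1] at p1; rw [h2] at p2; linarith
        · exact absurd (h1.trans h2.symm) hs
    subst hY
    exact ⟨hend e he _ hz1, hend f hf _ hz2⟩
  have hendne : ∀ e ∈ idx n, ∀ f ∈ idx n, e ≠ f →
      edgeEndpoints (edge e) ≠ edgeEndpoints (edge f) := by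
    intro e he f hf hne heq
    obtain ⟨a1, a2, -⟩ := mem_idx hcard he
    obtain ⟨b1, b2, -⟩ := mem_idx hcard hf
    have m1 : (edge e).1 ∈ edgeEndpoints (edge f) := by rw [← heq]; left; rfl
    have m2 : (edge e).2.2 ∈ edgeEndpoints (edge f) := by rw [← heq]; right; rfl
    have q1 : e.1 = f.1 ∨ e.1 = f.2 := by
      rcases m1 with h | h
      · exact Or.inl (hxinj _ _ (by omega) (by omega) (Phi_inj o hcs h).1)
      · exact Or.inr (hxinj _ _ (by omega) (by omega) (Phi_inj o hcs h).1)
    have q2 : e.2 = f.1 ∨ e.2 = f.2 := by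
      rcases m2 with h | h
      · exact Or.inl (hxinj _ _ (by omega) (by omega) (Phi_inj o hcs h).1)
      · exact Or.inr (hxinj _ _ (by omega) (by omega) (Phi_inj o hcs h).1)
    exact hne (Prod.ext (by omega) (by omega))
  have hsub : ∀ e, edgeEndpoints (edge e) ⊆ bendImage (edge e) := by
    intro e z hz
    rcases hz with h | h
    · left; rw [h]; exact left_mem_segment _ _ _
    · right; rw [h]; exact right_mem_segment _ _ _
  have himne : ∀ e ∈ idx n, ∀ f ∈ idx n, e ≠ f →
      bendImage (edge e) ≠ bendImage (edge f) := by
    intro e he f hf hne heq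
    have hi := hinter e he f hf hne
    rw [heq, Set.inter_self] at hi
    apply hendne e he f hf hne
    apply Set.Subset.antisymm
    · intro z hz
      have := hsub e hz
      rw [heq] at this
      exact (hi this).2
    · intro z hz
      exact (hi (hsub f hz)).1
  have hinj : Set.InjOn edge (idx n : Set (ℕ × ℕ)) := by
    intro e he f hf hef
    by_contra hne
    exact hendne e he f hf hne (by rw [hef])
  refine ⟨(idx n).image edge, ⟨⟨?_, ?_, ?_, ?_⟩, ?_⟩, ?_⟩
  · intro g hg
    obtain ⟨e, he, rfl⟩ := Finset.mem_image.1 hg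
    obtain ⟨a1, a2, -⟩ := mem_idx hcard he
    refine ⟨⟨?_, ?_⟩, (hP _).2 ⟨e.1, by omega, rfl⟩, (hP _).2 ⟨e.2, a2, rfl⟩⟩
    · intro h
      have := (Phi_inj o hcs h).1
      have := hx _ _ a1 a2
      linarith
    · refine bend_angle o hcs ?_ hα (hx _ _ a1 a2) (hδ _ _ _ _ a1 a2 a1 a2).1
      rcases side_or e with h | h <;> rw [h] <;> norm_num
  · intro g hg g' hg' hne
    obtain ⟨e, he, rfl⟩ := Finset.mem_image.1 hg
    obtain ⟨f, hf, rfl⟩ := Finset.mem_image.1 hg'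
    exact himne e he f hf (fun h => hne (by rw [h]))
  · intro g hg v hv hmem
    obtain ⟨e, he, rfl⟩ := Finset.mem_image.1 hg
    obtain ⟨i, hi, rfl⟩ := (hP v).1 hv
    exact hend e he _ hmem
  · intro g hg g' hg' hne
    obtain ⟨e, he, rfl⟩ := Finset.mem_image.1 hg
    obtain ⟨f, hf, rfl⟩ := Finset.mem_image.1 hg'
    exact hinter e he f hf (fun h => hne (by rw [h]))
  · intro g hg g' hg' hne
    obtain ⟨e, he, rfl⟩ := Finset.mem_image.1 hg
    obtain ⟨f, hf, rfl⟩ := Finset.mem_image.1 hg'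
    exact hendne e he f hf (fun h => hne (by rw [h]))
  · rw [Finset.card_image_of_injOn hinj, card_idx hcard]

/-- For collinear `P` with `n ≥ 3` points, the maximum number of edges of a plane
`α`-bend graph on `P` is `3n - 6`. -/
theorem stmt_3 (α : ℝ) (hα : α ∈ Set.Ioo 0 π) (P : Finset Pt)
    (hcard : 3 ≤ P.card) (hcol : Collinear ℝ (P : Set Pt)) :
    (∀ E : Finset (Pt × Pt × Pt), IsPlaneBendGraph α P E →
      E.card ≤ 3 * P.card - 6) ∧
    (∃ E : Finset (Pt × Pt × Pt), IsPlaneBendGraph α P E ∧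
      E.card = 3 * P.card - 6) := by
  exact ⟨fun E hE => upper_bound α P hcard hcol E hE, lower_bound α hα P hcard hcol⟩
end
end

section
/- For every α ∈ [π/2,π) and every finite collinear set P ⊂ ℝ² of n ≥ 3 points (all points of P lie on one line): every plane α-arc graph on P has at most 3n−6 edges and there exists one with exactly 3n−6 edges; and every plane α-arc multigraph on P has at most 4n−6 edges and there exists one with exactly 4n−6 edges. -/
open EuclideanGeometry Real Set

noncomputable section

/-! ### Coordinates adapted to the line -/

/-- First coordinate along the line. -/
def sC (o u x : Pt) : ℝ := (x 0 - o 0) * u 0 + (x 1 - o 1) * u 1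

/-- Signed distance to the line. -/
def tC (o u x : Pt) : ℝ := -(x 0 - o 0) * u 1 + (x 1 - o 1) * u 0

/-- Point with given coordinates. -/
def mkP (o u : Pt) (s t : ℝ) : Pt := !₂[o 0 + s * u 0 - t * u 1, o 1 + s * u 1 + t * u 0]

lemma sC_mkP (o u : Pt) (hu : u 0 ^ 2 + u 1 ^ 2 = 1) (s t : ℝ) : sC o u (mkP o u s t) = s := by
  simp only [sC, mkP, PiLp.toLp_apply, Matrix.cons_val_zero, Matrix.cons_val_one]
  linear_combination s * hu

lemma tC_mkP (o u : Pt) (hu : u 0 ^ 2 + u 1 ^ 2 = 1) (s t : ℝ) : tC o u (mkP o u s t) = t := by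
  simp only [tC, mkP, PiLp.toLp_apply, Matrix.cons_val_zero, Matrix.cons_val_one]
  linear_combination t * hu

lemma mkP_sC_tC (o u : Pt) (hu : u 0 ^ 2 + u 1 ^ 2 = 1) (x : Pt) :
    mkP o u (sC o u x) (tC o u x) = x := by
  ext i
  fin_cases i
  · simp [sC, tC, mkP]
    linear_combination (x 0 - o 0) * hu
  · simp [sC, tC, mkP]
    linear_combination (x 1 - o 1) * hu

lemma tC_zero_iff_mem (o u : Pt) (hu : u 0 ^ 2 + u 1 ^ 2 = 1) (A C : ℝ) (hAC : A ≠ C) (x : Pt) :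
    x ∈ affineSpan ℝ ({mkP o u A 0, mkP o u C 0} : Set Pt) ↔ tC o u x = 0 := by
  constructor
  · intro h
    obtain ⟨r, rfl⟩ := (mem_affineSpan_pair_iff_exists_lineMap_eq).1 h
    simp [AffineMap.lineMap_apply, tC, mkP]
    ring
  · intro h
    rw [mem_affineSpan_pair_iff_exists_lineMap_eq]
    refine ⟨(sC o u x - A) / (C - A), ?_⟩
    have h1 : C - A ≠ 0 := sub_ne_zero.2 hAC.symm
    rw [← mkP_sC_tC o u hu x, h, sC_mkP o u hu]
    ext i
    fin_cases i <;> simp [AffineMap.lineMap_apply, mkP] <;> field_simp <;> ring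

/-- The signed distance as a linear map (at the origin). -/
def tL (u : Pt) : Pt →ₗ[ℝ] ℝ where
  toFun x := -(x 0) * u 1 + (x 1) * u 0
  map_add' x y := by simp; ring
  map_smul' r x := by simp; ring

lemma tL_sub (o u x p : Pt) : tL u (x -ᵥ p) = tC o u x - tC o u p := by
  simp [tL, tC]; ring

lemma sSameSide_iff (o u : Pt) (hu : u 0 ^ 2 + u 1 ^ 2 = 1) (A C : ℝ) (hAC : A ≠ C) (x y : Pt) :
    (affineSpan ℝ ({mkP o u A 0, mkP o u C 0} : Set Pt)).SSameSide x y ↔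
      0 < tC o u x * tC o u y := by
  unfold AffineSubspace.SSameSide
  rw [tC_zero_iff_mem o u hu A C hAC, tC_zero_iff_mem o u hu A C hAC]
  constructor
  · rintro ⟨⟨p, hp, q, hq, h⟩, hx, hy⟩
    rw [tC_zero_iff_mem o u hu A C hAC] at hp hq
    have h2 := h.map (tL u)
    rw [tL_sub o, tL_sub o, hp, hq, sub_zero, sub_zero] at h2
    have h3 : 0 ≤ tC o u x * tC o u y := by
      rcases h2 with h2 | h2 | ⟨r1, r2, h1, h2, h3⟩
      · simp [h2]
      · simp [h2]
      · simp only [smul_eq_mul] at h3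
        have : tC o u y = r1 / r2 * tC o u x := by
          field_simp; linarith
        rw [this]
        have : 0 < r1 / r2 := by positivity
        nlinarith [mul_nonneg this.le (mul_self_nonneg (tC o u x))]
    exact lt_of_le_of_ne h3 (mul_ne_zero hx hy).symm
  · intro h
    refine ⟨?_, fun h0 => by simp [h0] at h, fun h0 => by simp [h0] at h⟩
    refine ⟨mkP o u (sC o u x) 0, ?_, mkP o u (sC o u y) 0, ?_, ?_⟩
    · rw [tC_zero_iff_mem o u hu A C hAC, tC_mkP o u hu]
    · rw [tC_zero_iff_mem o u hu A C hAC, tC_mkP o u hu]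
    · have key : ∀ z : Pt, z -ᵥ mkP o u (sC o u z) 0 = tC o u z • mkP 0 u 0 1 := by
        intro z
        conv_lhs => rw [← mkP_sC_tC o u hu z, sC_mkP o u hu]
        ext i
        fin_cases i <;> simp [mkP]
      rw [key, key]
      exact sameRay_smul_smul_of_mul_nonneg h.le

lemma angle_core (α I X N : ℝ) (h0 : 0 < α) (h1 : α < π) (hX : 0 < X) (hN : 0 < N)
    (hNN : N ^ 2 = I ^ 2 + X ^ 2) :
    Real.arccos (I / N) = α ↔ I * Real.sin α = X * Real.cos α := by
  have hs : 0 < Real.sin α := Real.sin_pos_of_pos_of_lt_pi h0 h1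
  have hsc := Real.sin_sq_add_cos_sq α
  constructor
  · intro h
    have hb : |I / N| ≤ 1 := by
      rw [abs_div, abs_of_pos hN, div_le_one hN]
      exact abs_le_of_sq_le_sq (by nlinarith) hN.le
    have hc : Real.cos α = I / N := by
      rw [← h, Real.cos_arccos (abs_le.1 hb).1 (abs_le.1 hb).2]
    have hI : I = N * Real.cos α := by rw [hc]; field_simp
    have hXs : X = N * Real.sin α := by
      have : X ^ 2 = (N * Real.sin α) ^ 2 := by
        have : X ^ 2 = N ^ 2 - I ^ 2 := by linarith
        rw [this, hI]; linear_combination (-N ^ 2) * hsc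
      exact (pow_left_inj₀ hX.le (by positivity) two_ne_zero).1 this
    rw [hI, hXs]; ring
  · intro h
    have hI : I = X / Real.sin α * Real.cos α := by field_simp; linarith
    have hN2 : N = X / Real.sin α := by
      refine (pow_left_inj₀ hN.le (by positivity) two_ne_zero).1 ?_
      rw [hNN, hI]
      field_simp
      linear_combination hsc
    have : I / N = Real.cos α := by
      rw [hI, ← hN2]; field_simp
    rw [this, Real.arccos_cos h0.le h1.le]

/-- Angle condition in coordinates. -/
lemma angle_iff (α : ℝ) (h0 : 0 < α) (h1 : α < π) (o u : Pt) (hu : u 0 ^ 2 + u 1 ^ 2 = 1)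
    (A C : ℝ) (hAC : A ≠ C) (x : Pt) (hx : tC o u x ≠ 0) :
    ∠ (mkP o u A 0) x (mkP o u C 0) = α ↔
      (tC o u x) ^ 2 + (-Real.cos α / Real.sin α) * |tC o u x| * |C - A|
        = (sC o u x - A) * (C - sC o u x) := by
  have hs : 0 < Real.sin α := Real.sin_pos_of_pos_of_lt_pi h0 h1
  obtain ⟨s, t, rfl⟩ : ∃ s t, x = mkP o u s t := ⟨_, _, (mkP_sC_tC o u hu x).symm⟩
  rw [tC_mkP o u hu] at *
  rw [sC_mkP o u hu]
  have hX : 0 < |t| * |C - A| := mul_pos (abs_pos.2 hx) (abs_pos.2 (sub_ne_zero.2 hAC.symm))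
  have hnorm : ∀ B, ‖mkP o u B 0 -ᵥ mkP o u s t‖ ^ 2 = (B - s) ^ 2 + t ^ 2 := by
    intro B
    rw [EuclideanSpace.norm_sq_eq]
    simp [mkP, Fin.sum_univ_two]
    linear_combination ((B - s) ^ 2 + t ^ 2) * hu
  have hI : inner ℝ (mkP o u A 0 -ᵥ mkP o u s t) (mkP o u C 0 -ᵥ mkP o u s t)
      = (A - s) * (C - s) + t ^ 2 := by
    simp [mkP, Fin.sum_univ_two, PiLp.inner_apply]
    linear_combination ((A - s) * (C - s) + t ^ 2) * hu
  have hpos : ∀ B, 0 < ‖mkP o u B 0 -ᵥ mkP o u s t‖ := by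
    intro B
    have : 0 < ‖mkP o u B 0 -ᵥ mkP o u s t‖ ^ 2 := by rw [hnorm]; positivity
    exact lt_of_le_of_ne (norm_nonneg _) (fun h => by rw [← h] at this; simp at this)
  unfold EuclideanGeometry.angle InnerProductGeometry.angle
  rw [angle_core α _ (|t| * |C - A|) _ h0 h1 hX (mul_pos (hpos A) (hpos C)), hI]
  · constructor
    · intro h
      field_simp
      linarith
    · intro h
      field_simp at h
      linarith
  · rw [mul_pow, hnorm, hnorm, hI, mul_pow, sq_abs, sq_abs]; ring

/-- Membership in an arc, in coordinates. -/
def OnArc (k A C s y : ℝ) : Prop := y ^ 2 + k * y * (C - A) = (s - A) * (C - s)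

lemma OnArc.mem_Ioo {k A C s y : ℝ} (hk : 0 ≤ k) (hy : 0 < y) (hAC : A < C)
    (h : OnArc k A C s y) : A < s ∧ s < C := by
  unfold OnArc at h
  have h1 : 0 < (s - A) * (C - s) := by
    rw [← h]
    have := mul_nonneg (mul_nonneg hk hy.le) (sub_nonneg.2 hAC.le)
    positivity
  constructor
  · by_contra hc
    nlinarith
  · by_contra hc
    nlinarith

lemma OnArc.nested {k A C A' C' s y : ℝ} (hk : 0 ≤ k) (hy : 0 < y) (hAC : A' < C')
    (hA : A ≤ A') (hC : C' ≤ C) (hne : A ≠ A' ∨ C ≠ C')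
    (h : OnArc k A C s y) (h' : OnArc k A' C' s y) : False := by
  obtain ⟨h1, h2⟩ := h'.mem_Ioo hk hy hAC
  unfold OnArc at h h'
  obtain ⟨p, rfl⟩ : ∃ p, A' = s - p := ⟨s - A', by ring⟩
  obtain ⟨q, rfl⟩ : ∃ q, C' = s + q := ⟨C' - s, by ring⟩
  obtain ⟨v, rfl⟩ : ∃ v, A = s - p - v := ⟨s - p - A, by ring⟩
  obtain ⟨w, rfl⟩ : ∃ w, C = s + q + w := ⟨C - s - q, by ring⟩
  have hp : 0 < p := by linarith
  have hq : 0 < q := by linarith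
  have hv : 0 ≤ v := by linarith
  have hw : 0 ≤ w := by linarith
  have hky : 0 ≤ k * y := by positivity
  have e1 : k * y * (p + q) < p * q := by nlinarith
  have e2 : k * y < q := by nlinarith
  have e3 : k * y < p := by nlinarith
  have e4 : p * w + v * q + v * w = k * y * (v + w) := by linarith
  have hvw : 0 < v + w := by
    rcases hne with h | h
    · have : v ≠ 0 := fun h0 => h (by rw [h0]; ring)
      have := lt_of_le_of_ne hv this.symm
      linarith
    · have : w ≠ 0 := fun h0 => h (by rw [h0]; ring)
      have := lt_of_le_of_ne hw this.symm
      linarith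
  have e5 : 0 ≤ v * w := by positivity
  rcases hv.lt_or_eq with hv' | hv'
  · nlinarith
  · have : 0 < w := by linarith
    nlinarith

/-- The height of the arc above `s`. -/
def arcH (k A C s : ℝ) : ℝ := (-(k * (C - A)) + √((k * (C - A)) ^ 2 + 4 * ((s - A) * (C - s)))) / 2

lemma arcH_onArc {k A C s : ℝ} (h : 0 ≤ (s - A) * (C - s)) : OnArc k A C s (arcH k A C s) := by
  unfold OnArc arcH
  have := Real.sq_sqrt (show 0 ≤ (k * (C - A)) ^ 2 + 4 * ((s - A) * (C - s)) by positivity)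
  nlinarith

lemma arcH_pos {k A C s : ℝ} (hk : 0 ≤ k) (h1 : A < s) (h2 : s < C) : 0 < arcH k A C s := by
  unfold arcH
  have h3 : 0 < (s - A) * (C - s) := mul_pos (by linarith) (by linarith)
  have h4 : 0 ≤ k * (C - A) := mul_nonneg hk (by linarith)
  have : k * (C - A) < √((k * (C - A)) ^ 2 + 4 * ((s - A) * (C - s))) :=
    Real.lt_sqrt_of_sq_lt (by linarith)
  linarith

lemma arcH_left {k A C : ℝ} (hk : 0 ≤ k) (h1 : A < C) : arcH k A C A = 0 := by
  unfold arcH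
  have h4 : 0 ≤ k * (C - A) := mul_nonneg hk (by linarith)
  simp [Real.sqrt_sq h4]

lemma arcH_right {k A C : ℝ} (hk : 0 ≤ k) (h1 : A < C) : arcH k A C C = 0 := by
  unfold arcH
  have h4 : 0 ≤ k * (C - A) := mul_nonneg hk (by linarith)
  simp [Real.sqrt_sq h4]

lemma crossing_meet {k A B C D : ℝ} (hk : 0 ≤ k) (h1 : A < B) (h2 : B < C) (h3 : C < D) :
    ∃ s y, 0 < y ∧ OnArc k A C s y ∧ OnArc k B D s y := by
  have hc : ∀ A C, Continuous (arcH k A C) := by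
    intro A C
    unfold arcH
    fun_prop
  obtain ⟨s, hs, hs0⟩ := intermediate_value_Icc' h2.le
    (f := fun s => arcH k A C s - arcH k B D s) ((hc A C).sub (hc B D)).continuousOn
    (show (0 : ℝ) ∈ Icc _ _ by
      constructor
      · simp only [arcH_right hk (h1.trans h2)]
        linarith [arcH_pos hk h2 h3]
      · simp only [arcH_left hk (h2.trans h3)]
        linarith [arcH_pos hk h1 h2])
  simp only at hs0
  have hs1 : B < s := by
    refine lt_of_le_of_ne hs.1 ?_
    rintro rfl
    rw [arcH_left hk (h2.trans h3)] at hs0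
    linarith [arcH_pos hk h1 h2]
  have hs2 : s ≤ C := hs.2
  refine ⟨s, arcH k B D s, arcH_pos hk hs1 (by linarith), ?_, ?_⟩
  · rw [show arcH k B D s = arcH k A C s by linarith]
    exact arcH_onArc (mul_nonneg (by linarith) (by linarith))
  · exact arcH_onArc (mul_nonneg (by linarith) (by linarith))
/-! ### Noncrossing families of intervals -/

/-- No two intervals of the family interleave. -/
def NonCross (F : Finset (ℕ × ℕ)) : Prop :=
  ∀ e ∈ F, ∀ f ∈ F, ¬ (e.1 < f.1 ∧ f.1 < e.2 ∧ e.2 < f.2)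

lemma noncross_aux (F : Finset (ℕ × ℕ)) (hlt : ∀ e ∈ F, e.1 < e.2) (hF : NonCross F) :
    ∀ d a b : ℕ, b = a + d + 1 →
      (F.filter (fun e => a ≤ e.1 ∧ e.2 ≤ b)).card ≤ 2 * d + 1 := by
  intro d
  induction d using Nat.strong_induction_on with
  | _ d ih =>
  intro a b hb
  rcases Nat.eq_zero_or_pos d with hd | hd
  · subst hd
    have : F.filter (fun e => a ≤ e.1 ∧ e.2 ≤ b) ⊆ {(a, b)} := by
      intro e he
      rw [Finset.mem_filter] at he
      have := hlt e he.1
      rw [Finset.mem_singleton]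
      ext <;> simp <;> omega
    simpa using Finset.card_le_card this
  · -- choose the splitting vertex
    have key : ∃ c, a < c ∧ c < b ∧ ∀ e ∈ F, a ≤ e.1 → e.2 ≤ b → e ≠ (a, b) →
        (e.2 ≤ c ∨ c ≤ e.1) := by
      by_cases hex : ∃ c, c < b ∧ (a, c) ∈ F
      · have hex' : ∃ c, c ≤ b ∧ (c < b ∧ (a, c) ∈ F) := by
          obtain ⟨c, h1, h2⟩ := hex; exact ⟨c, h1.le, h1, h2⟩
        classical
        set c := Nat.findGreatest (fun c => c < b ∧ (a, c) ∈ F) b with hc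
        obtain ⟨c0, hc0, hc0'⟩ := hex'
        have hcs : c < b ∧ (a, c) ∈ F :=
          Nat.findGreatest_spec (P := fun c => c < b ∧ (a, c) ∈ F) hc0 hc0'
        refine ⟨c, hlt _ hcs.2, hcs.1, ?_⟩
        intro e he h1 h2 hne
        by_contra hcon
        push Not at hcon
        rcases h1.lt_or_eq with h1 | h1
        · exact hF _ hcs.2 e he ⟨h1, hcon.2, hcon.1⟩
        · have h3 : e.2 ≠ b := fun h3 => hne (by ext <;> simp [h1, h3])
          have h4 : (a, e.2) ∈ F := by rw [h1]; exact he
          have := Nat.le_findGreatest (P := fun c => c < b ∧ (a, c) ∈ F) h2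
            ⟨lt_of_le_of_ne h2 h3, h4⟩
          omega
      · refine ⟨a + 1, by omega, by omega, ?_⟩
        intro e he h1 h2 hne
        by_contra hcon
        push Not at hcon
        have h1' : e.1 = a := by omega
        have h3 : e.2 ≠ b := fun h3 => hne (by ext <;> simp [h1', h3])
        exact hex ⟨e.2, lt_of_le_of_ne h2 h3, by rw [← h1']; exact he⟩
    obtain ⟨c, hac, hcb, hc⟩ := key
    have hsub : F.filter (fun e => a ≤ e.1 ∧ e.2 ≤ b) ⊆
        {(a, b)} ∪ (F.filter (fun e => a ≤ e.1 ∧ e.2 ≤ c) ∪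
          F.filter (fun e => c ≤ e.1 ∧ e.2 ≤ b)) := by
      intro e he
      rw [Finset.mem_filter] at he
      obtain ⟨he, h1, h2⟩ := he
      simp only [Finset.mem_union, Finset.mem_singleton, Finset.mem_filter]
      by_cases hne : e = (a, b)
      · exact Or.inl hne
      · rcases hc e he h1 h2 hne with h | h
        · exact Or.inr (Or.inl ⟨he, h1, h⟩)
        · exact Or.inr (Or.inr ⟨he, h, h2⟩)
    have i1 := ih (c - a - 1) (by omega) a c (by omega)
    have i2 := ih (b - c - 1) (by omega) c b (by omega)
    have i3 := Finset.card_le_card hsub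
    have i4 := Finset.card_union_le {(a, b)} (F.filter (fun e => a ≤ e.1 ∧ e.2 ≤ c) ∪
          F.filter (fun e => c ≤ e.1 ∧ e.2 ≤ b))
    have i5 := Finset.card_union_le (F.filter (fun e => a ≤ e.1 ∧ e.2 ≤ c))
          (F.filter (fun e => c ≤ e.1 ∧ e.2 ≤ b))
    rw [Finset.card_singleton] at i4
    omega

lemma noncross_card (n : ℕ) (hn : 3 ≤ n) (F : Finset (ℕ × ℕ))
    (hlt : ∀ e ∈ F, e.1 < e.2 ∧ e.2 < n) (hF : NonCross F) : F.card + 3 ≤ 2 * n := by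
  have h := noncross_aux F (fun e he => (hlt e he).1) hF (n - 2) 0 (n - 1) (by omega)
  rw [Finset.filter_true_of_mem] at h
  · omega
  · intro e he
    have := hlt e he
    omega

/-- The boundary cycle. -/
def cyc (n : ℕ) : Finset (ℕ × ℕ) :=
  insert (0, n - 1) ((Finset.range (n - 1)).image (fun i => (i, i + 1)))

lemma cyc_card (n : ℕ) (hn : 3 ≤ n) : (cyc n).card = n := by
  unfold cyc
  rw [Finset.card_insert_of_notMem, Finset.card_image_of_injective, Finset.card_range]
  · omega
  · intro i j h
    simpa using h
  · simp only [Finset.mem_image, Finset.mem_range, Prod.mk.injEq, not_exists, not_and]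
    intro x hx h1 h2
    omega

lemma mem_cyc (n : ℕ) (e : ℕ × ℕ) : e ∈ cyc n ↔
    (e.1 = 0 ∧ e.2 = n - 1) ∨ (e.1 < n - 1 ∧ e.2 = e.1 + 1) := by
  obtain ⟨i, j⟩ := e
  simp only [cyc, Finset.mem_insert, Finset.mem_image, Finset.mem_range, Prod.mk.injEq]
  constructor
  · rintro (h | ⟨a, h1, h2, h3⟩)
    · exact Or.inl h
    · right; omega
  · rintro (h | h)
    · exact Or.inl h
    · exact Or.inr ⟨i, h.1, rfl, h.2.symm⟩

lemma noncross_diag (n : ℕ) (hn : 3 ≤ n) (F : Finset (ℕ × ℕ))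
    (hlt : ∀ e ∈ F, e.1 < e.2 ∧ e.2 < n) (hF : NonCross F) : (F \ cyc n).card + 3 ≤ n := by
  have h := noncross_card n hn (F ∪ cyc n) (by
    intro e he
    rw [Finset.mem_union, mem_cyc] at he
    rcases he with he | he
    · exact hlt e he
    · omega) (by
    intro e he f hf
    rw [Finset.mem_union, mem_cyc] at he hf
    rcases he with he | he <;> rcases hf with hf | hf
    · exact hF e he f hf
    · have := hlt e he; omega
    · have := hlt f hf; omega
    · omega)
  have h2 : (F ∪ cyc n).card = (F \ cyc n).card + (cyc n).card := by
    rw [← Finset.sdiff_union_self_eq_union, Finset.card_union_of_disjoint Finset.sdiff_disjoint]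
  rw [cyc_card n hn] at h2
  omega

/-- Fan at `0` plus consecutive pairs. -/
def famA (n : ℕ) : Finset (ℕ × ℕ) :=
  (Finset.range (n - 1)).image (fun j => (0, j + 1)) ∪
    (Finset.range (n - 2)).image (fun i => (i + 1, i + 2))

/-- Diagonals of the fan at `n - 1`. -/
def famB (n : ℕ) : Finset (ℕ × ℕ) := (Finset.range (n - 3)).image (fun i => (i + 1, n - 1))

lemma mem_famA (n : ℕ) (e : ℕ × ℕ) : e ∈ famA n ↔
    (e.1 = 0 ∧ 1 ≤ e.2 ∧ e.2 < n) ∨ (1 ≤ e.1 ∧ e.2 = e.1 + 1 ∧ e.2 < n) := by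
  obtain ⟨i, j⟩ := e
  simp only [famA, Finset.mem_union, Finset.mem_image, Finset.mem_range, Prod.mk.injEq]
  constructor
  · rintro (⟨a, h1, h2, h3⟩ | ⟨a, h1, h2, h3⟩)
    · left; omega
    · right; omega
  · rintro (h | h)
    · exact Or.inl ⟨j - 1, by omega, by omega, by omega⟩
    · exact Or.inr ⟨i - 1, by omega, by omega, by omega⟩

lemma mem_famB (n : ℕ) (e : ℕ × ℕ) : e ∈ famB n ↔
    (1 ≤ e.1 ∧ e.1 + 2 < n ∧ e.2 = n - 1) := by
  obtain ⟨i, j⟩ := e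
  simp only [famB, Finset.mem_image, Finset.mem_range, Prod.mk.injEq]
  constructor
  · rintro ⟨a, h1, h2, h3⟩
    omega
  · intro h
    exact ⟨i - 1, by omega, by omega, by omega⟩

lemma famA_card (n : ℕ) (hn : 3 ≤ n) : (famA n).card = 2 * n - 3 := by
  unfold famA
  rw [Finset.card_union_of_disjoint, Finset.card_image_of_injective,
    Finset.card_image_of_injective, Finset.card_range, Finset.card_range]
  · omega
  · intro i j h; simpa using h
  · intro i j h; simpa using h
  · rw [Finset.disjoint_left]
    intro e he hf
    simp only [Finset.mem_image] at he hf
    obtain ⟨a, -, rfl⟩ := he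
    obtain ⟨b, -, hb⟩ := hf
    simp at hb

lemma famB_card (n : ℕ) : (famB n).card = n - 3 := by
  unfold famB
  rw [Finset.card_image_of_injective, Finset.card_range]
  intro i j h; simpa using h

lemma famA_noncross (n : ℕ) : NonCross (famA n) := by
  intro e he f hf
  rw [mem_famA] at he hf
  omega

lemma famB_noncross (n : ℕ) : NonCross (famB n) := by
  intro e he f hf
  rw [mem_famB] at he hf
  omega

/-! ### Arcs in coordinates -/

/-- The endpoints of `e` are the points with coordinates `A` and `C` on the line. -/
def ArcRep (o u : Pt) (e : Pt × Pt × Pt) (A C : ℝ) : Prop :=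
  (e.1 = mkP o u A 0 ∧ e.2.2 = mkP o u C 0) ∨ (e.1 = mkP o u C 0 ∧ e.2.2 = mkP o u A 0)

lemma ArcRep.endpoints {o u : Pt} {e : Pt × Pt × Pt} {A C : ℝ} (h : ArcRep o u e A C) :
    edgeEndpoints e = {mkP o u A 0, mkP o u C 0} := by
  unfold edgeEndpoints
  rcases h with ⟨h1, h2⟩ | ⟨h1, h2⟩
  · rw [h1, h2]
  · rw [h1, h2, Set.pair_comm]

lemma ArcRep.tC_endpoint {o u : Pt} (hu : u 0 ^ 2 + u 1 ^ 2 = 1) {e : Pt × Pt × Pt} {A C : ℝ}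
    (h : ArcRep o u e A C) {x : Pt} (hx : x ∈ edgeEndpoints e) : tC o u x = 0 := by
  rw [h.endpoints] at hx
  rcases hx with rfl | rfl <;> exact tC_mkP o u hu _ _

/-- The constant of the arc family. -/
def kOf (α : ℝ) : ℝ := -Real.cos α / Real.sin α

lemma kOf_nonneg {α : ℝ} (hα : α ∈ Set.Ico (π / 2) π) : 0 ≤ kOf α := by
  unfold kOf
  have h0 : 0 < α := lt_of_lt_of_le (by positivity) hα.1
  refine div_nonneg ?_ (Real.sin_pos_of_pos_of_lt_pi h0 hα.2).le
  have := Real.cos_nonpos_of_pi_div_two_le_of_le hα.1 (by linarith [hα.2, Real.pi_pos])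
  linarith

lemma angle_iff_onArc {α : ℝ} (hα : α ∈ Set.Ico (π / 2) π) {o u : Pt}
    (hu : u 0 ^ 2 + u 1 ^ 2 = 1) {e : Pt × Pt × Pt} {A C : ℝ} (hAC : A < C) (h : ArcRep o u e A C)
    (x : Pt) (hx : tC o u x ≠ 0) :
    ∠ e.1 x e.2.2 = α ↔ OnArc (kOf α) A C (sC o u x) |tC o u x| := by
  have h0 : 0 < α := lt_of_lt_of_le (by positivity) hα.1
  have key := angle_iff α h0 hα.2 o u hu A C hAC.ne x hx
  rw [abs_of_pos (sub_pos.2 hAC)] at key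
  have h2 : ∠ e.1 x e.2.2 = ∠ (mkP o u A 0) x (mkP o u C 0) := by
    rcases h with ⟨h1, h2⟩ | ⟨h1, h2⟩
    · rw [h1, h2]
    · rw [h1, h2, EuclideanGeometry.angle_comm]
  rw [h2, key, OnArc, sq_abs, kOf]

lemma ArcRep.span {o u : Pt} {e : Pt × Pt × Pt} {A C : ℝ} (h : ArcRep o u e A C) :
    ({e.1, e.2.2} : Set Pt) = {mkP o u A 0, mkP o u C 0} := h.endpoints

lemma IsArcEdge.tC_ne {α : ℝ} {o u : Pt} (hu : u 0 ^ 2 + u 1 ^ 2 = 1) {e : Pt × Pt × Pt}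
    {A C : ℝ} (hAC : A < C) (h : ArcRep o u e A C) (he : IsArcEdge α e) : tC o u e.2.1 ≠ 0 := by
  have := he.2.1
  rwa [h.span, tC_zero_iff_mem o u hu A C hAC.ne] at this

lemma mem_arcImage {α : ℝ} (hα : α ∈ Set.Ico (π / 2) π) {o u : Pt}
    (hu : u 0 ^ 2 + u 1 ^ 2 = 1) {e : Pt × Pt × Pt} {A C : ℝ} (hAC : A < C) (h : ArcRep o u e A C)
    (he : IsArcEdge α e) (x : Pt) :
    x ∈ arcImage e ↔ x ∈ edgeEndpoints e ∨
      (0 < tC o u x * tC o u e.2.1 ∧ OnArc (kOf α) A C (sC o u x) |tC o u x|) := by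
  unfold arcImage
  rw [Set.mem_union]
  refine or_congr Iff.rfl ?_
  rw [Set.mem_ofPred_eq, h.span, sSameSide_iff o u hu A C hAC.ne, he.2.2]
  refine and_congr_right fun hx => ?_
  exact angle_iff_onArc hα hu hAC h x (fun h0 => by simp [h0] at hx)

lemma apex_mem {α : ℝ} (hα : α ∈ Set.Ico (π / 2) π) {o u : Pt}
    (hu : u 0 ^ 2 + u 1 ^ 2 = 1) {e : Pt × Pt × Pt} {A C : ℝ} (hAC : A < C) (h : ArcRep o u e A C)
    (he : IsArcEdge α e) : e.2.1 ∈ arcImage e := by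
  have h0 := he.tC_ne hu hAC h
  rw [mem_arcImage hα hu hAC h he]
  exact Or.inr ⟨mul_self_pos.2 h0, (angle_iff_onArc hα hu hAC h _ h0).1 he.2.2⟩

/-- Two arcs that do not interleave only meet in common endpoints. -/
lemma arcs_inter {α : ℝ} (hα : α ∈ Set.Ico (π / 2) π) {o u : Pt}
    (hu : u 0 ^ 2 + u 1 ^ 2 = 1) {e f : Pt × Pt × Pt} {A C B D : ℝ}
    (hAC : A < C) (he : ArcRep o u e A C) (hea : IsArcEdge α e)
    (hBD : B < D) (hf : ArcRep o u f B D) (hfa : IsArcEdge α f)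
    (hne : 0 < tC o u e.2.1 * tC o u f.2.1 → (A ≠ B ∨ C ≠ D) ∧
      ¬ (A < B ∧ B < C ∧ C < D) ∧ ¬ (B < A ∧ A < D ∧ D < C)) :
    arcImage e ∩ arcImage f ⊆ edgeEndpoints e ∩ edgeEndpoints f := by
  rintro x ⟨hxe, hxf⟩
  rw [mem_arcImage hα hu hAC he hea] at hxe
  rw [mem_arcImage hα hu hBD hf hfa] at hxf
  rcases hxe with hxe | ⟨hxe, hxe2⟩
  · rcases hxf with hxf | ⟨hxf, hxf2⟩
    · exact ⟨hxe, hxf⟩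
    · simp [he.tC_endpoint hu hxe] at hxf
  · rcases hxf with hxf | ⟨hxf, hxf2⟩
    · simp [hf.tC_endpoint hu hxf] at hxe
    · exfalso
      have hk := kOf_nonneg hα
      have hx0 : tC o u x ≠ 0 := fun h0 => by simp [h0] at hxe
      have hy : 0 < |tC o u x| := abs_pos.2 hx0
      have hs : 0 < tC o u e.2.1 * tC o u f.2.1 := by
        have := mul_pos hxe hxf
        by_contra hcon
        push Not at hcon
        nlinarith [mul_self_pos.2 hx0]
      obtain ⟨h1, h2, h3⟩ := hne hs
      have e1 := hxe2.mem_Ioo hk hy hAC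
      have e2 := hxf2.mem_Ioo hk hy hBD
      rcases le_or_gt A B with hAB | hAB
      · rcases le_or_gt D C with hDC | hDC
        · exact OnArc.nested hk hy hBD hAB hDC h1 hxe2 hxf2
        · rcases hAB.lt_or_eq with hAB | hAB
          · exact h2 ⟨hAB, e2.1.trans e1.2, hDC⟩
          · exact OnArc.nested hk hy hAC hAB.ge hDC.le (Or.inr hDC.ne') hxf2 hxe2
      · rcases le_or_gt C D with hDC | hDC
        · exact OnArc.nested hk hy hAC hAB.le hDC (Or.inl hAB.ne) hxf2 hxe2
        · exact h3 ⟨hAB, e1.1.trans e2.2, hDC⟩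

/-- Two arcs on the same side which interleave or coincide meet off the line. -/
lemma arcs_meet {α : ℝ} (hα : α ∈ Set.Ico (π / 2) π) {o u : Pt}
    (hu : u 0 ^ 2 + u 1 ^ 2 = 1) {e f : Pt × Pt × Pt} {A C B D : ℝ}
    (hAC : A < C) (he : ArcRep o u e A C) (hea : IsArcEdge α e)
    (hBD : B < D) (hf : ArcRep o u f B D) (hfa : IsArcEdge α f)
    (hs : 0 < tC o u e.2.1 * tC o u f.2.1)
    (hc : (A = B ∧ C = D) ∨ (A < B ∧ B < C ∧ C < D)) :
    ¬ (arcImage e ∩ arcImage f ⊆ edgeEndpoints e ∩ edgeEndpoints f) := by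
  intro hsub
  have hk := kOf_nonneg hα
  obtain ⟨x, hx, hx1, hx2⟩ : ∃ x, 0 < tC o u x * tC o u e.2.1 ∧
      OnArc (kOf α) A C (sC o u x) |tC o u x| ∧ OnArc (kOf α) B D (sC o u x) |tC o u x| := by
    rcases hc with ⟨rfl, rfl⟩ | ⟨h1, h2, h3⟩
    · have h0 := hea.tC_ne hu hAC he
      have := (angle_iff_onArc hα hu hAC he _ h0).1 hea.2.2
      exact ⟨e.2.1, mul_self_pos.2 h0, this, this⟩
    · obtain ⟨s, y, hy, h4, h5⟩ := crossing_meet hk h1 h2 h3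
      rcases lt_or_gt_of_ne (hea.tC_ne hu hAC he) with h0 | h0
      · refine ⟨mkP o u s (-y), ?_, ?_, ?_⟩ <;> rw [tC_mkP o u hu]
        · nlinarith
        · rwa [sC_mkP o u hu, abs_neg, abs_of_pos hy]
        · rwa [sC_mkP o u hu, abs_neg, abs_of_pos hy]
      · refine ⟨mkP o u s y, ?_, ?_, ?_⟩ <;> rw [tC_mkP o u hu]
        · positivity
        · rwa [sC_mkP o u hu, abs_of_pos hy]
        · rwa [sC_mkP o u hu, abs_of_pos hy]
  have hxf : 0 < tC o u x * tC o u f.2.1 := by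
    have := mul_pos hx hs
    by_contra hcon
    push Not at hcon
    nlinarith [mul_self_nonneg (tC o u e.2.1)]
  have m1 : x ∈ arcImage e := (mem_arcImage hα hu hAC he hea x).2 (Or.inr ⟨hx, hx1⟩)
  have m2 : x ∈ arcImage f := (mem_arcImage hα hu hBD hf hfa x).2 (Or.inr ⟨hxf, hx2⟩)
  have := he.tC_endpoint hu (hsub ⟨m1, m2⟩).1
  simp [this] at hx

/-- Parametrization of a collinear set. -/
lemma param (P : Finset Pt) (hcard : 3 ≤ P.card) (hcol : Collinear ℝ (P : Set Pt)) :
    ∃ (o u : Pt) (A : ℕ → ℝ), u 0 ^ 2 + u 1 ^ 2 = 1 ∧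
      (∀ i j, i < j → j < P.card → A i < A j) ∧
      ∀ p, p ∈ P ↔ ∃ i < P.card, p = mkP o u (A i) 0 := by
  classical
  obtain ⟨o, v, hv⟩ := (collinear_iff_exists_forall_eq_smul_vadd (k := ℝ) (P : Set Pt)).1 hcol
  have hv0 : v ≠ 0 := by
    rintro rfl
    have : P ⊆ {o} := by
      intro p hp
      obtain ⟨r, hr⟩ := hv p hp
      simp [hr]
    have := Finset.card_le_card this
    rw [Finset.card_singleton] at this
    omega
  have hn : ‖v‖ ≠ 0 := norm_ne_zero_iff.2 hv0
  have hnsq : ‖v‖ ^ 2 = v 0 ^ 2 + v 1 ^ 2 := by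
    rw [EuclideanSpace.norm_sq_eq]; simp [Fin.sum_univ_two]
  obtain ⟨u, hu⟩ : ∃ u : Pt, u = ‖v‖⁻¹ • v := ⟨_, rfl⟩
  have hu1 : u 0 ^ 2 + u 1 ^ 2 = 1 := by
    rw [hu]
    simp only [PiLp.smul_apply, smul_eq_mul]
    field_simp
    linarith
  have hP : ∀ p ∈ P, ∃ s, p = mkP o u s 0 := by
    intro p hp
    obtain ⟨r, hr⟩ := hv p hp
    refine ⟨r * ‖v‖, ?_⟩
    rw [hr, hu]
    ext i
    fin_cases i <;> simp [mkP] <;> field_simp <;> ring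
  have hP' : ∀ p ∈ P, p = mkP o u (sC o u p) 0 := by
    intro p hp
    obtain ⟨s, rfl⟩ := hP p hp
    rw [sC_mkP o u hu1]
  have hT : (P.image (sC o u)).card = P.card := by
    apply Finset.card_image_of_injOn
    intro p hp q hq h
    rw [hP' p hp, hP' q hq, h]
  refine ⟨o, u, fun i => if h : i < P.card then (P.image (sC o u)).orderEmbOfFin hT ⟨i, h⟩ else 0,
    hu1, ?_, ?_⟩
  · intro i j hij hj
    simp only [hj, hij.trans hj, dif_pos]
    simpa using hij
  · intro p
    constructor
    · intro hp
      have h1 : sC o u p ∈ Set.range ((P.image (sC o u)).orderEmbOfFin hT) := by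
        rw [Finset.range_orderEmbOfFin]
        exact Finset.mem_coe.2 (Finset.mem_image_of_mem _ hp)
      obtain ⟨i, hi⟩ := h1
      refine ⟨i, i.2, ?_⟩
      simp only [i.2, dif_pos]
      rw [hi]
      exact hP' p hp
    · rintro ⟨i, hi, rfl⟩
      simp only [hi, dif_pos]
      have h1 := Finset.orderEmbOfFin_mem (P.image (sC o u)) hT ⟨i, hi⟩
      obtain ⟨q, hq, hq2⟩ := Finset.mem_image.1 h1
      rw [← hq2, ← hP' q hq]
      exact hq

/-! ### Upper bounds -/

lemma upper {α : ℝ} (hα : α ∈ Set.Ico (π / 2) π) (P : Finset Pt) {o u : Pt} {A : ℕ → ℝ}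
    (hu : u 0 ^ 2 + u 1 ^ 2 = 1)
    (hA : ∀ i j, i < j → j < P.card → A i < A j)
    (hP : ∀ p, p ∈ P ↔ ∃ i < P.card, p = mkP o u (A i) 0)
    (E : Finset (Pt × Pt × Pt)) (hE : IsPlaneArcMultigraph α P E) :
    ∃ φ : Pt × Pt × Pt → ℕ × ℕ,
      (∀ e ∈ E, (φ e).1 < (φ e).2 ∧ (φ e).2 < P.card ∧ ArcRep o u e (A (φ e).1) (A (φ e).2)) ∧
      ∃ E₁ E₂ : Finset (Pt × Pt × Pt), E = E₁ ∪ E₂ ∧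
        (∀ G, (G = E₁ ∨ G = E₂) → Set.InjOn φ G ∧ NonCross (G.image φ)) := by
  have hex : ∀ e ∈ E, ∃ q : ℕ × ℕ, q.1 < q.2 ∧ q.2 < P.card ∧ ArcRep o u e (A q.1) (A q.2) := by
    intro e he
    obtain ⟨⟨hne, -, -⟩, h1, h2⟩ := hE.1 e he
    obtain ⟨i, hi, hi2⟩ := (hP _).1 h1
    obtain ⟨j, hj, hj2⟩ := (hP _).1 h2
    rcases lt_trichotomy i j with h | h | h
    · exact ⟨(i, j), h, hj, Or.inl ⟨hi2, hj2⟩⟩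
    · subst h
      exact absurd (hi2.trans hj2.symm) hne
    · exact ⟨(j, i), h, hi, Or.inr ⟨hi2, hj2⟩⟩
  choose! φ hφ using hex
  have hpair : ∀ e ∈ E, ∀ f ∈ E, e ≠ f → 0 < tC o u e.2.1 * tC o u f.2.1 →
      φ e ≠ φ f ∧ ¬ ((φ e).1 < (φ f).1 ∧ (φ f).1 < (φ e).2 ∧ (φ e).2 < (φ f).2) := by
    intro e he f hf hne hs
    obtain ⟨a1, a2, a3⟩ := hφ e he
    obtain ⟨b1, b2, b3⟩ := hφ f hf
    have key := fun hc => arcs_meet hα hu (hA _ _ a1 a2) a3 (hE.1 e he).1 (hA _ _ b1 b2) b3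
      (hE.1 f hf).1 hs hc (hE.2.2.2 e he f hf hne)
    constructor
    · intro h
      exact key (Or.inl (by rw [h]; exact ⟨rfl, rfl⟩))
    · rintro ⟨h1, h2, h3⟩
      exact key (Or.inr ⟨hA _ _ h1 (by omega), hA _ _ h2 a2, hA _ _ h3 b2⟩)
  refine ⟨φ, hφ, E.filter (fun e => 0 < tC o u e.2.1), E.filter (fun e => ¬ 0 < tC o u e.2.1),
    (Finset.filter_union_filter_not_eq _ _).symm, ?_⟩
  intro G hG
  have hG2 : ∀ e ∈ G, ∀ f ∈ G, e ∈ E ∧ f ∈ E ∧ 0 < tC o u e.2.1 * tC o u f.2.1 := by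
    intro e he f hf
    rcases hG with rfl | rfl
    · rw [Finset.mem_filter] at he hf
      exact ⟨he.1, hf.1, mul_pos he.2 hf.2⟩
    · rw [Finset.mem_filter] at he hf
      refine ⟨he.1, hf.1, ?_⟩
      have n1 : ∀ e ∈ E, tC o u e.2.1 ≠ 0 := fun e he =>
        ((hE.1 e he).1).tC_ne hu (hA _ _ (hφ e he).1 (hφ e he).2.1) (hφ e he).2.2
      exact mul_pos_of_neg_of_neg (lt_of_le_of_ne (not_lt.1 he.2) (n1 e he.1))
        (lt_of_le_of_ne (not_lt.1 hf.2) (n1 f hf.1))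
  constructor
  · intro e he f hf h
    by_contra hne
    obtain ⟨h1, h2, h3⟩ := hG2 e he f hf
    exact (hpair e h1 f h2 hne h3).1 h
  · intro p hp q hq
    obtain ⟨e, he, rfl⟩ := Finset.mem_image.1 hp
    obtain ⟨f, hf, rfl⟩ := Finset.mem_image.1 hq
    obtain ⟨h1, h2, h3⟩ := hG2 e he f hf
    by_cases hne : e = f
    · subst hne; omega
    · exact (hpair e h1 f h2 hne h3).2

/-! ### Construction -/

/-- The sign attached to a side. -/
def sgn (σ : Bool) : ℝ := if σ then 1 else -1

/-- The arc edge on side `σ` between vertices `i` and `j`. -/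
def mkE (α : ℝ) (o u : Pt) (A : ℕ → ℝ) (d : Bool × ℕ × ℕ) : Pt × Pt × Pt :=
  (mkP o u (A d.2.1) 0,
   mkP o u ((A d.2.1 + A d.2.2) / 2)
     (sgn d.1 * arcH (kOf α) (A d.2.1) (A d.2.2) ((A d.2.1 + A d.2.2) / 2)),
   mkP o u (A d.2.2) 0)

lemma lower {α : ℝ} (hα : α ∈ Set.Ico (π / 2) π) (P : Finset Pt) {o u : Pt} {A : ℕ → ℝ}
    (hu : u 0 ^ 2 + u 1 ^ 2 = 1)
    (hA : ∀ i j, i < j → j < P.card → A i < A j)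
    (hP : ∀ p, p ∈ P ↔ ∃ i < P.card, p = mkP o u (A i) 0)
    (D : Finset (Bool × ℕ × ℕ)) (hD : ∀ d ∈ D, d.2.1 < d.2.2 ∧ d.2.2 < P.card)
    (hX : ∀ d ∈ D, ∀ d' ∈ D, d.1 = d'.1 →
      ¬ (d.2.1 < d'.2.1 ∧ d'.2.1 < d.2.2 ∧ d.2.2 < d'.2.2)) :
    ∃ E : Finset (Pt × Pt × Pt), IsPlaneArcMultigraph α P E ∧ E.card = D.card ∧
      ((∀ d ∈ D, ∀ d' ∈ D, d.2 = d'.2 → d = d') → IsPlaneArcGraph α P E) := by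
  classical
  have hk := kOf_nonneg hα
  have hAinj : ∀ i j, i < P.card → j < P.card → A i = A j → i = j := by
    intro i j hi hj h
    rcases lt_trichotomy i j with h1 | h1 | h1
    · exact absurd h (hA i j h1 hj).ne
    · exact h1
    · exact absurd h (hA j i h1 hi).ne'
  have hAlt : ∀ i j, i < P.card → j < P.card → A i < A j → i < j := by
    intro i j hi hj h
    by_contra hc
    rcases (not_lt.1 hc).lt_or_eq with h1 | h1
    · exact absurd h (hA j i h1 hi).not_gt
    · subst h1; exact lt_irrefl _ h
  have hlt : ∀ d ∈ D, A d.2.1 < A d.2.2 := fun d hd => hA _ _ (hD d hd).1 (hD d hd).2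
  have hrep : ∀ d, ArcRep o u (mkE α o u A d) (A d.2.1) (A d.2.2) := fun d => Or.inl ⟨rfl, rfl⟩
  have hH : ∀ d ∈ D, 0 < arcH (kOf α) (A d.2.1) (A d.2.2) ((A d.2.1 + A d.2.2) / 2) := by
    intro d hd
    have := hlt d hd
    exact arcH_pos hk (by linarith) (by linarith)
  have htC : ∀ d, tC o u (mkE α o u A d).2.1 =
      sgn d.1 * arcH (kOf α) (A d.2.1) (A d.2.2) ((A d.2.1 + A d.2.2) / 2) :=
    fun d => tC_mkP o u hu _ _
  have hne0 : ∀ d ∈ D, tC o u (mkE α o u A d).2.1 ≠ 0 := by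
    intro d hd
    rw [htC]
    refine mul_ne_zero ?_ (hH d hd).ne'
    unfold sgn; split_ifs <;> norm_num
  have hside : ∀ d ∈ D, ∀ d' ∈ D,
      0 < tC o u (mkE α o u A d).2.1 * tC o u (mkE α o u A d').2.1 → d.1 = d'.1 := by
    intro d hd d' hd' h
    rw [htC, htC] at h
    have h1 := hH d hd
    have h2 := hH d' hd'
    have h3 := mul_pos h1 h2
    obtain ⟨σ, q⟩ := d
    obtain ⟨σ', q'⟩ := d'
    cases σ <;> cases σ' <;> simp [sgn] at h ⊢ <;> simp at h3 <;> linarith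
  have hedge : ∀ d ∈ D, IsArcEdge α (mkE α o u A d) := by
    intro d hd
    have h1 := hlt d hd
    refine ⟨?_, ?_, ?_⟩
    · intro h
      have := congrArg (sC o u) h
      simp only [mkE, sC_mkP o u hu] at this
      exact h1.ne this
    · rw [(hrep d).span, tC_zero_iff_mem o u hu _ _ h1.ne]
      exact hne0 d hd
    · rw [angle_iff_onArc hα hu h1 (hrep d) _ (hne0 d hd), htC]
      have h2 : |sgn d.1 * arcH (kOf α) (A d.2.1) (A d.2.2) ((A d.2.1 + A d.2.2) / 2)| =
          arcH (kOf α) (A d.2.1) (A d.2.2) ((A d.2.1 + A d.2.2) / 2) := by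
        rw [abs_mul, abs_of_pos (hH d hd)]
        unfold sgn; split_ifs <;> simp
      rw [h2]
      have h3 : sC o u (mkE α o u A d).2.1 = (A d.2.1 + A d.2.2) / 2 := sC_mkP o u hu _ _
      rw [h3]
      exact arcH_onArc (mul_nonneg (by linarith) (by linarith))
  have hinter : ∀ d ∈ D, ∀ d' ∈ D, d ≠ d' →
      arcImage (mkE α o u A d) ∩ arcImage (mkE α o u A d') ⊆
        edgeEndpoints (mkE α o u A d) ∩ edgeEndpoints (mkE α o u A d') := by
    intro d hd d' hd' hne
    refine arcs_inter hα hu (hlt d hd) (hrep d) (hedge d hd) (hlt d' hd') (hrep d') (hedge d' hd') ?_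
    intro hs
    have hs' := hside d hd d' hd' hs
    obtain ⟨p1, p2⟩ := hD d hd
    obtain ⟨p3, p4⟩ := hD d' hd'
    refine ⟨?_, ?_, ?_⟩
    · by_contra hcon
      push Not at hcon
      exact hne (Prod.ext hs' (Prod.ext (hAinj _ _ (by omega) (by omega) hcon.1)
        (hAinj _ _ p2 p4 hcon.2)))
    · rintro ⟨h1, h2, h3⟩
      exact hX d hd d' hd' hs' ⟨hAlt _ _ (by omega) (by omega) h1, hAlt _ _ (by omega) p2 h2,
        hAlt _ _ p2 p4 h3⟩
    · rintro ⟨h1, h2, h3⟩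
      exact hX d' hd' d hd hs'.symm ⟨hAlt _ _ (by omega) (by omega) h1, hAlt _ _ (by omega) p4 h2,
        hAlt _ _ p4 p2 h3⟩
  have himg : ∀ d ∈ D, ∀ d' ∈ D, d ≠ d' →
      arcImage (mkE α o u A d) ≠ arcImage (mkE α o u A d') := by
    intro d hd d' hd' hne h
    have h1 := apex_mem hα hu (hlt d hd) (hrep d) (hedge d hd)
    have h2 := hinter d hd d' hd' hne ⟨h1, h ▸ h1⟩
    exact hne0 d hd ((hrep d).tC_endpoint hu h2.1)
  have hmulti : IsPlaneArcMultigraph α P (D.image (mkE α o u A)) := by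
    refine ⟨?_, ?_, ?_, ?_⟩
    · intro e he
      obtain ⟨d, hd, rfl⟩ := Finset.mem_image.1 he
      obtain ⟨p1, p2⟩ := hD d hd
      exact ⟨hedge d hd, (hP _).2 ⟨_, p1.trans p2, rfl⟩, (hP _).2 ⟨_, p2, rfl⟩⟩
    · intro e he f hf hne
      obtain ⟨d, hd, rfl⟩ := Finset.mem_image.1 he
      obtain ⟨d', hd', rfl⟩ := Finset.mem_image.1 hf
      exact himg d hd d' hd' (fun h => hne (by rw [h]))
    · intro e he v hv hve
      obtain ⟨d, hd, rfl⟩ := Finset.mem_image.1 he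
      obtain ⟨i, -, rfl⟩ := (hP v).1 hv
      rcases (mem_arcImage hα hu (hlt d hd) (hrep d) (hedge d hd) _).1 hve with h | ⟨h, -⟩
      · exact h
      · rw [tC_mkP o u hu] at h
        simp at h
    · intro e he f hf hne
      obtain ⟨d, hd, rfl⟩ := Finset.mem_image.1 he
      obtain ⟨d', hd', rfl⟩ := Finset.mem_image.1 hf
      exact hinter d hd d' hd' (fun h => hne (by rw [h]))
  refine ⟨D.image (mkE α o u A), hmulti, ?_, ?_⟩
  · apply Finset.card_image_of_injOn
    intro d hd d' hd' h
    by_contra hne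
    exact himg d hd d' hd' hne (by rw [h])
  · intro hinj
    refine ⟨hmulti, ?_⟩
    intro e he f hf hne h
    obtain ⟨d, hd, rfl⟩ := Finset.mem_image.1 he
    obtain ⟨d', hd', rfl⟩ := Finset.mem_image.1 hf
    apply hne
    congr 1
    apply hinj d hd d' hd'
    obtain ⟨p1, p2⟩ := hD d hd
    obtain ⟨p3, p4⟩ := hD d' hd'
    have h2 : Set.image (sC o u) (edgeEndpoints (mkE α o u A d)) =
        Set.image (sC o u) (edgeEndpoints (mkE α o u A d')) := by rw [h]
    rw [(hrep d).endpoints, (hrep d').endpoints, Set.image_pair, Set.image_pair] at h2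
    simp only [sC_mkP o u hu] at h2
    rcases Set.pair_eq_pair_iff.1 h2 with ⟨h3, h4⟩ | ⟨h3, h4⟩
    · exact Prod.ext (hAinj _ _ (by omega) (by omega) h3) (hAinj _ _ p2 p4 h4)
    · have := hlt d hd
      have := hlt d' hd'
      linarith

/-- For `α ∈ [π/2, π)` and collinear `P` with `n ≥ 3` points, the maximum number of edges
of a plane `α`-arc graph on `P` is `3n - 6`, and of a plane `α`-arc multigraph is `4n - 6`. -/
theorem stmt_4 (α : ℝ) (hα : α ∈ Set.Ico (π/2) π) (P : Finset Pt)
    (hcard : 3 ≤ P.card) (hcol : Collinear ℝ (P : Set Pt)) :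
    ((∀ E : Finset (Pt × Pt × Pt), IsPlaneArcGraph α P E → E.card ≤ 3 * P.card - 6) ∧
     (∃ E : Finset (Pt × Pt × Pt), IsPlaneArcGraph α P E ∧ E.card = 3 * P.card - 6)) ∧
    ((∀ E : Finset (Pt × Pt × Pt), IsPlaneArcMultigraph α P E → E.card ≤ 4 * P.card - 6) ∧
     (∃ E : Finset (Pt × Pt × Pt), IsPlaneArcMultigraph α P E ∧ E.card = 4 * P.card - 6)) := by
  classical
  obtain ⟨o, u, A, hu, hA, hP⟩ := param P hcard hcol
  refine ⟨⟨?_, ?_⟩, ⟨?_, ?_⟩⟩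
  · intro E hE
    obtain ⟨φ, hφ, E₁, E₂, rfl, h12⟩ := upper hα P hu hA hP E hE.1
    obtain ⟨i1, n1⟩ := h12 E₁ (Or.inl rfl)
    obtain ⟨i2, n2⟩ := h12 E₂ (Or.inr rfl)
    have d1 := noncross_diag P.card hcard (E₁.image φ) (by
      intro p hp
      obtain ⟨e, he, rfl⟩ := Finset.mem_image.1 hp
      have := hφ e (Finset.mem_union_left _ he)
      exact ⟨this.1, this.2.1⟩) n1
    have d2 := noncross_diag P.card hcard (E₂.image φ) (by
      intro p hp
      obtain ⟨e, he, rfl⟩ := Finset.mem_image.1 hp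
      have := hφ e (Finset.mem_union_right _ he)
      exact ⟨this.1, this.2.1⟩) n2
    have hinj : Set.InjOn φ ((E₁ ∪ E₂ : Finset (Pt × Pt × Pt)) : Set (Pt × Pt × Pt)) := by
      intro e he f hf h
      by_contra hne
      apply hE.2 e he f hf hne
      rw [(hφ e he).2.2.endpoints, (hφ f hf).2.2.endpoints, h]
    rw [← Finset.card_image_of_injOn hinj]
    have hsub : (E₁ ∪ E₂).image φ ⊆
        ((E₁.image φ \ cyc P.card) ∪ (E₂.image φ \ cyc P.card)) ∪ cyc P.card := by
      rw [Finset.image_union]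
      intro p hp
      simp only [Finset.mem_union, Finset.mem_sdiff] at hp ⊢
      tauto
    have c1 := Finset.card_le_card hsub
    have c2 := Finset.card_union_le ((E₁.image φ \ cyc P.card) ∪ (E₂.image φ \ cyc P.card))
      (cyc P.card)
    have c3 := Finset.card_union_le (E₁.image φ \ cyc P.card) (E₂.image φ \ cyc P.card)
    have c4 := cyc_card P.card hcard
    omega
  · obtain ⟨E, -, h2, h3⟩ := lower hα P hu hA hP
      ((famA P.card).image (fun q => (true, q)) ∪ (famB P.card).image (fun q => (false, q)))
      (by
        intro d hd
        simp only [Finset.mem_union, Finset.mem_image] at hd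
        rcases hd with ⟨q, hq, rfl⟩ | ⟨q, hq, rfl⟩
        · rw [mem_famA] at hq
          simp only
          omega
        · rw [mem_famB] at hq
          simp only
          omega)
      (by
        intro d hd d' hd' hs
        simp only [Finset.mem_union, Finset.mem_image] at hd hd'
        rcases hd with ⟨q, hq, rfl⟩ | ⟨q, hq, rfl⟩ <;>
          rcases hd' with ⟨q', hq', rfl⟩ | ⟨q', hq', rfl⟩
        · exact famA_noncross _ q hq q' hq'
        · simp at hs
        · simp at hs
        · exact famB_noncross _ q hq q' hq')
    refine ⟨E, h3 ?_, ?_⟩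
    · intro d hd d' hd' hs
      simp only [Finset.mem_union, Finset.mem_image] at hd hd'
      rcases hd with ⟨q, hq, rfl⟩ | ⟨q, hq, rfl⟩ <;>
        rcases hd' with ⟨q', hq', rfl⟩ | ⟨q', hq', rfl⟩
      · simpa using hs
      · simp only at hs
        subst hs
        rw [mem_famA] at hq
        rw [mem_famB] at hq'
        omega
      · simp only at hs
        subst hs
        rw [mem_famB] at hq
        rw [mem_famA] at hq'
        omega
      · simpa using hs
    · rw [h2, Finset.card_union_of_disjoint, Finset.card_image_of_injective,
        Finset.card_image_of_injective, famA_card _ hcard, famB_card]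
      · omega
      · intro p q h; simpa using h
      · intro p q h; simpa using h
      · rw [Finset.disjoint_left]
        intro e he hf
        simp only [Finset.mem_image] at he hf
        obtain ⟨a, -, rfl⟩ := he
        obtain ⟨b, -, hb⟩ := hf
        simp at hb
  · intro E hE
    obtain ⟨φ, hφ, E₁, E₂, rfl, h12⟩ := upper hα P hu hA hP E hE
    obtain ⟨i1, n1⟩ := h12 E₁ (Or.inl rfl)
    obtain ⟨i2, n2⟩ := h12 E₂ (Or.inr rfl)
    have d1 := noncross_card P.card hcard (E₁.image φ) (by
      intro p hp
      obtain ⟨e, he, rfl⟩ := Finset.mem_image.1 hp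
      have := hφ e (Finset.mem_union_left _ he)
      exact ⟨this.1, this.2.1⟩) n1
    have d2 := noncross_card P.card hcard (E₂.image φ) (by
      intro p hp
      obtain ⟨e, he, rfl⟩ := Finset.mem_image.1 hp
      have := hφ e (Finset.mem_union_right _ he)
      exact ⟨this.1, this.2.1⟩) n2
    rw [Finset.card_image_of_injOn i1] at d1
    rw [Finset.card_image_of_injOn i2] at d2
    have := Finset.card_union_le E₁ E₂
    omega
  · obtain ⟨E, h1, h2, -⟩ := lower hα P hu hA hP
      ((famA P.card).image (fun q => (true, q)) ∪ (famA P.card).image (fun q => (false, q)))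
      (by
        intro d hd
        simp only [Finset.mem_union, Finset.mem_image] at hd
        rcases hd with ⟨q, hq, rfl⟩ | ⟨q, hq, rfl⟩
        · rw [mem_famA] at hq
          simp only
          omega
        · rw [mem_famA] at hq
          simp only
          omega)
      (by
        intro d hd d' hd' hs
        simp only [Finset.mem_union, Finset.mem_image] at hd hd'
        rcases hd with ⟨q, hq, rfl⟩ | ⟨q, hq, rfl⟩ <;>
          rcases hd' with ⟨q', hq', rfl⟩ | ⟨q', hq', rfl⟩
        · exact famA_noncross _ q hq q' hq'
        · simp at hs
        · simp at hs
        · exact famA_noncross _ q hq q' hq')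
    refine ⟨E, h1, ?_⟩
    rw [h2, Finset.card_union_of_disjoint, Finset.card_image_of_injective,
        Finset.card_image_of_injective, famA_card _ hcard]
    · omega
    · intro p q h; simpa using h
    · intro p q h; simpa using h
    · rw [Finset.disjoint_left]
      intro e he hf
      simp only [Finset.mem_image] at he hf
      obtain ⟨a, -, rfl⟩ := he
      obtain ⟨b, -, hb⟩ := hf
      simp at hb
end
end

section
/- For every α ∈ (0,π/2) and every finite collinear set P ⊂ ℝ² of n ≥ 3 points (all points of P lie on one line): every plane α-arc graph on P has at most 2n−3 edges and there exists one with exactly 2n−3 edges; and every plane α-arc multigraph on P has at most 2n−2 edges and there exists one with exactly 2n−2 edges. -/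
open EuclideanGeometry Real Set

noncomputable section

/-- Combinatorial bound for one side of the line. -/
theorem comb_bound_s5 (V : Finset ℝ) (F : Finset (ℝ × ℝ))
    (h1 : ∀ p ∈ F, p.1 ∈ V ∧ p.2 ∈ V ∧ p.1 < p.2)
    (h2 : ∀ p ∈ F, ∀ q ∈ F, p.1 < q.1 → q.1 ≤ p.2 → p.2 < q.2 → False)
    (hV : V.Nonempty) : F.card + 1 ≤ V.card := by
  classical
  have key : ∀ p ∈ F, ∃ k ∈ V, p.1 ≤ k ∧ k < p.2 ∧ (k = p.1 ∨ (p.1, k) ∈ F) ∧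
      ∀ l, l < p.2 → (p.1, l) ∈ F → l ≤ k := by
    intro p hp
    obtain ⟨ha, hb, hab⟩ := h1 p hp
    have hne : (V.filter (fun k => k < p.2 ∧ (k = p.1 ∨ (p.1, k) ∈ F))).Nonempty :=
      ⟨p.1, by simp [ha, hab]⟩
    obtain ⟨k, hk, hmax⟩ := Finset.exists_max_image _ (fun x : ℝ => x) hne
    simp only [Finset.mem_filter] at hk hmax
    refine ⟨k, hk.1, hmax p.1 ⟨ha, hab, Or.inl rfl⟩, hk.2.1, hk.2.2, ?_⟩
    intro l hl hlF
    exact hmax l ⟨(h1 _ hlF).2.1, hl, Or.inr hlF⟩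
  choose! g hgV hg1 hg2 hg3 hg4 using key
  obtain ⟨M, hM, hMmax⟩ := Finset.exists_max_image V (fun x : ℝ => x) hV
  have hcard : F.card ≤ (V.erase M).card := by
    apply Finset.card_le_card_of_injOn g
    · intro p hp
      have hp' : p ∈ F := hp
      simp only [Finset.coe_erase, mem_sdiff, Finset.mem_coe, mem_singleton_iff]
      refine ⟨hgV p hp', ?_⟩
      have := hg2 p hp'
      have := hMmax p.2 (h1 p hp').2.1
      intro h
      linarith
    · have main : ∀ p ∈ F, ∀ q ∈ F, g p = g q → p.1 < q.1 → False := by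
        intro p hp q hq h hlt
        have a1 := hg1 q hq
        have a2 := hg2 q hq
        rcases hg3 p hp with h3 | h3
        · linarith
        · exact h2 _ h3 q hq hlt (by simpa [h] using a1) (by simpa [h] using a2)
      have main2 : ∀ p ∈ F, ∀ q ∈ F, g p = g q → p.1 = q.1 → p.2 < q.2 → False := by
        intro p hp q hq h heq hlt
        have := hg4 q hq p.2 hlt (by rw [← heq]; exact hp)
        have := hg2 p hp
        linarith
      intro p hp q hq h
      have e1 : p.1 = q.1 := by
        rcases lt_trichotomy p.1 q.1 with h' | h' | h'
        · exact (main p hp q hq h h').elim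
        · exact h'
        · exact (main q hq p hp h.symm h').elim
      have e2 : p.2 = q.2 := by
        rcases lt_trichotomy p.2 q.2 with h' | h' | h'
        · exact (main2 p hp q hq h e1 h').elim
        · exact h'
        · exact (main2 q hq p hp h.symm e1.symm h').elim
      exact Prod.ext e1 e2
  rw [Finset.card_erase_of_mem hM] at hcard
  have := Finset.card_pos.mpr hV
  omega

theorem comb_bound' (V : Finset ℝ) (F : Finset (ℝ × ℝ))
    (h1 : ∀ p ∈ F, p.1 ∈ V ∧ p.2 ∈ V ∧ p.1 < p.2)
    (h2 : ∀ p ∈ F, ∀ q ∈ F, p.1 < q.1 → q.1 ≤ p.2 → p.2 < q.2 → False)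
    (m M : ℝ) (hm : m ∈ V) (hM : M ∈ V) (hmM : m < M)
    (hmin : ∀ x ∈ V, m ≤ x) (hmax : ∀ x ∈ V, x ≤ M) (hF : (m, M) ∉ F) :
    F.card + 2 ≤ V.card := by
  classical
  have := comb_bound_s5 V (insert (m, M) F) ?_ ?_ ⟨m, hm⟩
  · rw [Finset.card_insert_of_notMem hF] at this
    omega
  · intro p hp
    rcases Finset.mem_insert.mp hp with rfl | hp
    · exact ⟨hm, hM, hmM⟩
    · exact h1 p hp
  · intro p hp q hq a b c
    rcases Finset.mem_insert.mp hp with rfl | hp <;> rcases Finset.mem_insert.mp hq with rfl | hq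
    · exact lt_irrefl _ a
    · have := hmax _ (h1 q hq).2.1
      simp only at c
      linarith
    · have := hmin _ (h1 p hp).1
      simp only at a
      linarith
    · exact h2 p hp q hq a b c

/-- Two arcs with chords `[i,j]`, `[k,l]`, `i < k ≤ j < l`, on the same side, cross. -/
theorem arcs_cross (s i j k l : ℝ) (hs : 0 < s) (h1 : i < k) (h2 : k ≤ j) (h3 : j < l) :
    ∃ x y : ℝ, 0 < y ∧ (x - i) * (x - j) + y ^ 2 = s * (j - i) * y ∧
      (x - k) * (x - l) + y ^ 2 = s * (l - k) * y := by
  have hD : 0 < k + l - i - j := by linarith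
  obtain ⟨D, hDdef⟩ : ∃ D, D = k + l - i - j := ⟨_, rfl⟩
  rw [← hDdef] at hD
  obtain ⟨m, hm⟩ : ∃ m, m * D = s * ((j - i) - (l - k)) :=
    ⟨s * ((j - i) - (l - k)) / D, by field_simp⟩
  obtain ⟨x0, hx0⟩ : ∃ x0, x0 * D = k * l - i * j := ⟨(k * l - i * j) / D, by field_simp⟩
  -- any point of the radical axis on the first circle is on the second
  have hrad : ∀ x y : ℝ, x = x0 + m * y → (x - i) * (x - j) + y ^ 2 = s * (j - i) * y →
      (x - k) * (x - l) + y ^ 2 = s * (l - k) * y := by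
    intro x y hx h
    have : x * D = k * l - i * j + s * ((j - i) - (l - k)) * y := by
      rw [hx]; linear_combination hx0 + y * hm
    rw [hDdef] at this
    linear_combination h - this
  have hxi : (x0 - i) * D = (k - i) * (l - i) := by
    rw [sub_mul, hx0, hDdef]; ring
  have hxj : (x0 - j) * D = (k - j) * (l - j) := by
    rw [sub_mul, hx0, hDdef]; ring
  have p1 : 0 < x0 - i := by
    have : 0 < (x0 - i) * D := by
      rw [hxi]; exact mul_pos (by linarith) (by linarith)
    exact pos_of_mul_pos_left this hD.le
  suffices h : ∃ y : ℝ, 0 < y ∧ (x0 + m * y - i) * (x0 + m * y - j) + y ^ 2 = s * (j - i) * y by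
    obtain ⟨y, hy, h⟩ := h
    exact ⟨x0 + m * y, y, hy, h, hrad _ y rfl h⟩
  rcases h2.eq_or_lt with h2 | h2
  · subst h2
    have hx : x0 = k := by
      have : (x0 - k) * D = 0 := by rw [hxj]; ring
      have := (mul_eq_zero.mp this).resolve_right hD.ne'
      linarith
    have hsm : 0 < s - m := by
      have : (s - m) * D = s * (2 * (l - k)) := by
        rw [sub_mul, hm, hDdef]; ring
      have h' : 0 < (s - m) * D := by
        rw [this]; exact mul_pos hs (by linarith)
      exact pos_of_mul_pos_left h' hD.le
    refine ⟨(k - i) * (s - m) / (m ^ 2 + 1), by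
      have : 0 < k - i := by linarith
      positivity, ?_⟩
    rw [hx]
    have : m ^ 2 + 1 ≠ 0 := by positivity
    field_simp
    ring
  · have p2 : x0 - j < 0 := by
      have : (x0 - j) * D < 0 := by
        rw [hxj]; exact mul_neg_of_neg_of_pos (by linarith) (by linarith)
      by_contra hc
      push Not at hc
      have := mul_nonneg hc hD.le
      linarith
    obtain ⟨A, hA⟩ : ∃ A, A = m ^ 2 + 1 := ⟨_, rfl⟩
    obtain ⟨B, hB⟩ : ∃ B, B = m * (x0 - i) + m * (x0 - j) - s * (j - i) := ⟨_, rfl⟩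
    obtain ⟨C, hC⟩ : ∃ C, C = (x0 - i) * (x0 - j) := ⟨_, rfl⟩
    have hApos : 0 < A := by rw [hA]; positivity
    have hCneg : C < 0 := by rw [hC]; exact mul_neg_of_pos_of_neg p1 p2
    have hdisc : B ^ 2 < B ^ 2 - 4 * A * C := by nlinarith
    have hnn : 0 ≤ B ^ 2 - 4 * A * C := by nlinarith [sq_nonneg B]
    have hlt : |B| < √(B ^ 2 - 4 * A * C) := by
      rw [← Real.sqrt_sq_eq_abs]
      exact Real.sqrt_lt_sqrt (sq_nonneg B) hdisc
    have hsq := Real.sq_sqrt hnn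
    set r := √(B ^ 2 - 4 * A * C) with hr
    refine ⟨(-B + r) / (2 * A), by
      have : 0 < -B + r := by linarith [le_abs_self B]
      positivity, ?_⟩
    have hq : A * ((-B + r) / (2 * A)) ^ 2 + B * ((-B + r) / (2 * A)) + C = 0 := by
      field_simp
      linear_combination hsq
    generalize (-B + r) / (2 * A) = y at hq
    rw [hA, hB, hC] at hq
    linear_combination hq

theorem star_disj (s σ a c d x y : ℝ) (hy : 0 < y) (hcd : c ≠ d)
    (h1 : (x - a) * (x - c) + y ^ 2 = s * (σ * (c - a)) * y)
    (h2 : (x - a) * (x - d) + y ^ 2 = s * (σ * (d - a)) * y) : False := by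
  have h3 : (c - d) * ((x - a) + s * σ * y) = 0 := by linear_combination h2 - h1
  have h4 := (mul_eq_zero.mp h3).resolve_left (sub_ne_zero.mpr hcd)
  have h5 : (x - a) ^ 2 + y ^ 2 = 0 := by linear_combination h1 + (c - a) * h4
  nlinarith [sq_nonneg (x - a)]

/-- An orthonormal frame of the plane. -/
structure Frame where
  p : Pt
  v0 : ℝ
  v1 : ℝ
  ε : ℝ
  hv : v0 ^ 2 + v1 ^ 2 = 1
  hε : ε ^ 2 = 1

namespace Frame

def T (f : Frame) (x : Pt) : ℝ := f.v0 * (x 0 - f.p 0) + f.v1 * (x 1 - f.p 1)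
def Y (f : Frame) (x : Pt) : ℝ := f.ε * (-f.v1 * (x 0 - f.p 0) + f.v0 * (x 1 - f.p 1))
def mk' (f : Frame) (t y : ℝ) : Pt :=
  !₂[f.p 0 + t * f.v0 - f.ε * y * f.v1, f.p 1 + t * f.v1 + f.ε * y * f.v0]
def flip (f : Frame) : Frame := ⟨f.p, f.v0, f.v1, -f.ε, f.hv, by rw [neg_sq, f.hε]⟩

theorem T_flip (f : Frame) (x : Pt) : f.flip.T x = f.T x := rfl
theorem Y_flip (f : Frame) (x : Pt) : f.flip.Y x = - f.Y x := by
  simp only [Y, flip]; ring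

theorem T_mk (f : Frame) (t y : ℝ) : f.T (f.mk' t y) = t := by
  simp [T, mk']
  linear_combination t * f.hv
theorem Y_mk (f : Frame) (t y : ℝ) : f.Y (f.mk' t y) = y := by
  simp [Y, mk']
  linear_combination f.ε ^ 2 * y * f.hv + y * f.hε

theorem mk_TY (f : Frame) (x : Pt) : f.mk' (f.T x) (f.Y x) = x := by
  ext i
  fin_cases i
  · simp [T, Y, mk']
    linear_combination (x 0 - f.p 0) * f.hv - f.v1 * (-f.v1 * (x 0 - f.p 0) + f.v0 * (x 1 - f.p 1)) * f.hε
  · simp [T, Y, mk']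
    linear_combination (x 1 - f.p 1) * f.hv + f.v0 * (-f.v1 * (x 0 - f.p 0) + f.v0 * (x 1 - f.p 1)) * f.hε

theorem ext' (f : Frame) {x y : Pt} (h1 : f.T x = f.T y) (h2 : f.Y x = f.Y y) : x = y := by
  rw [← f.mk_TY x, ← f.mk_TY y, h1, h2]

theorem mem_span (f : Frame) {a c : Pt} (ha : f.Y a = 0) (hc : f.Y c = 0) (hac : a ≠ c) (x : Pt) :
    x ∈ affineSpan ℝ ({a, c} : Set Pt) ↔ f.Y x = 0 := by
  rw [mem_affineSpan_pair_iff_exists_lineMap_eq]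
  have hl : ∀ r : ℝ, f.T (AffineMap.lineMap a c r) = f.T a + r * (f.T c - f.T a) ∧
      f.Y (AffineMap.lineMap a c r) = f.Y a + r * (f.Y c - f.Y a) := by
    intro r
    constructor
    · simp [T, AffineMap.lineMap_apply]; ring
    · simp [Y, AffineMap.lineMap_apply]; ring
  have hne : f.T c - f.T a ≠ 0 := by
    intro h
    exact hac (f.ext' (by linarith) (by rw [ha, hc]))
  constructor
  · rintro ⟨r, rfl⟩
    rw [(hl r).2, ha, hc]; ring
  · intro hx
    refine ⟨(f.T x - f.T a) / (f.T c - f.T a), f.ext' ?_ ?_⟩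
    · rw [(hl _).1]; field_simp; ring
    · rw [(hl _).2, ha, hc, hx]; ring

theorem sameSide (f : Frame) {a c : Pt} (ha : f.Y a = 0) (hc : f.Y c = 0) (hac : a ≠ c)
    (x b : Pt) (hb : 0 < f.Y b) :
    (affineSpan ℝ ({a, c} : Set Pt)).SSameSide x b ↔ 0 < f.Y x := by
  have hmem : a ∈ affineSpan ℝ ({a, c} : Set Pt) := by rw [f.mem_span ha hc hac]; exact ha
  have hlin : ∀ (q u w : Pt) (r : ℝ), f.Y (q - r • (u - w)) = f.Y q - r * (f.Y u - f.Y w) := by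
    intro q u w r
    simp [Y]; ring
  rw [AffineSubspace.sSameSide_iff_exists_right hmem] 
  simp only [f.mem_span ha hc hac]
  constructor
  · rintro ⟨hx, -, p, hp, hr⟩
    simp only [vsub_eq_sub] at hr
    obtain ⟨r1, r2, h1, h2, h⟩ := hr.exists_pos (by
        intro h; rw [sub_eq_zero] at h; exact hx (by rw [h, hp])) (by
        intro h; rw [sub_eq_zero] at h; rw [h, ha] at hb; exact lt_irrefl _ hb)
    have e0 : (0 : Pt) - r1 • (x - p) = 0 - r2 • (b - a) := by rw [h]
    have e1 := hlin 0 x p r1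
    rw [e0, hlin, hp, ha] at e1
    have : 0 < r1 * f.Y x := by
      have := mul_pos h2 hb
      linarith
    exact pos_of_mul_pos_right this h1.le
  · intro hx
    refine ⟨hx.ne', hb.ne', x - (f.Y x / f.Y b) • (b - a), ?_, ?_⟩
    · rw [hlin, ha]; field_simp; ring
    · simp only [vsub_eq_sub, sub_sub_cancel]
      exact SameRay.sameRay_nonneg_smul_left _ (by positivity)

theorem inner_eq (f : Frame) (a x c : Pt) : inner ℝ (a - x) (c - x) =
    (f.T a - f.T x) * (f.T c - f.T x) + (f.Y a - f.Y x) * (f.Y c - f.Y x) := by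
  simp only [PiLp.inner_apply, Fin.sum_univ_two, RCLike.inner_apply, conj_trivial, PiLp.sub_apply, T, Y]
  linear_combination (-(a 0 - x 0) * (c 0 - x 0) - (a 1 - x 1) * (c 1 - x 1)) * f.hv
    - (-f.v1 * (a 0 - x 0) + f.v0 * (a 1 - x 1)) * (-f.v1 * (c 0 - x 0) + f.v0 * (c 1 - x 1)) * f.hε

end Frame

namespace Frame

theorem angle_iff (f : Frame) (α : ℝ) (hα : α ∈ Set.Ioo 0 (π/2)) {a c : Pt} (ha : f.Y a = 0)
    (hc : f.Y c = 0) (hac : a ≠ c) (x : Pt) (hx : 0 < f.Y x) :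
    ∠ a x c = α ↔ (f.T x - f.T a) * (f.T x - f.T c) + f.Y x ^ 2 =
      (cos α / sin α) * |f.T c - f.T a| * f.Y x := by
  have hne : f.T c - f.T a ≠ 0 := by
    intro h
    exact hac (f.ext' (by linarith) (by rw [ha, hc]))
  have hsin : 0 < sin α := sin_pos_of_pos_of_lt_pi hα.1 (by linarith [hα.2, pi_pos])
  have hsc := sin_sq_add_cos_sq α
  have hI := f.inner_eq a x c
  have hu := f.inner_eq a x a
  have hw := f.inner_eq c x c
  rw [real_inner_self_eq_norm_sq] at hu hw
  rw [ha, hc] at hI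
  rw [ha] at hu
  rw [hc] at hw
  have hau : 0 < ‖a - x‖ := by
    rw [norm_pos_iff, sub_ne_zero]; rintro rfl; linarith
  have hcw : 0 < ‖c - x‖ := by
    rw [norm_pos_iff, sub_ne_zero]; rintro rfl; linarith
  have hN : 0 < ‖a - x‖ * ‖c - x‖ := mul_pos hau hcw
  have hC : 0 < |f.T c - f.T a| * f.Y x := mul_pos (abs_pos.mpr hne) hx
  have hrel : (‖a - x‖ * ‖c - x‖) ^ 2 = (inner ℝ (a - x) (c - x)) ^ 2 +
      (|f.T c - f.T a| * f.Y x) ^ 2 := by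
    rw [mul_pow, hu, hw, hI, mul_pow, sq_abs]; ring
  have hI' : (f.T x - f.T a) * (f.T x - f.T c) + f.Y x ^ 2 = inner ℝ (a - x) (c - x) := by
    rw [hI]; ring
  rw [hI']
  have hcos : ∠ a x c = α ↔ inner ℝ (a - x) (c - x) = ‖a - x‖ * ‖c - x‖ * cos α := by
    have e : cos (∠ a x c) = inner ℝ (a - x) (c - x) / (‖a - x‖ * ‖c - x‖) := by
      unfold EuclideanGeometry.angle
      rw [InnerProductGeometry.cos_angle]; rfl
    constructor
    · intro h
      rw [h] at e
      rw [e]; field_simp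
    · intro h
      rw [h] at e
      have e' : cos (∠ a x c) = cos α := by rw [e]; field_simp
      exact injOn_cos ⟨EuclideanGeometry.angle_nonneg _ _ _, EuclideanGeometry.angle_le_pi _ _ _⟩
        ⟨hα.1.le, by linarith [hα.2, pi_pos]⟩ e'
  rw [hcos, mul_assoc (cos α / sin α)]
  generalize (inner ℝ (a - x) (c - x) : ℝ) = I at *
  generalize ‖a - x‖ * ‖c - x‖ = N at *
  generalize |f.T c - f.T a| * f.Y x = C at *
  constructor
  · intro h
    have h1 : C ^ 2 = (N * sin α) ^ 2 := by
      rw [h] at hrel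
      linear_combination -hrel - N ^ 2 * hsc
    have h2 : C = N * sin α := by
      rwa [sq_eq_sq₀ hC.le (by positivity)] at h1
    rw [h, h2]; field_simp
  · intro h
    have h0 : I * sin α = cos α * C := by rw [h]; field_simp
    have h1 : C ^ 2 = (N * sin α) ^ 2 := by
      linear_combination -(sin α) ^ 2 * hrel - C ^ 2 * hsc - (I * sin α + cos α * C) * h0
    have h2 : C = N * sin α := by
      rwa [sq_eq_sq₀ hC.le (by positivity)] at h1
    rw [h, h2]; field_simp

/-- Description of an arc in the upper half plane of a frame. -/
theorem mem_arc (f : Frame) (α : ℝ) (hα : α ∈ Set.Ioo 0 (π/2)) (e : Pt × Pt × Pt)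
    (he : IsArcEdge α e) (ha : f.Y e.1 = 0) (hc : f.Y e.2.2 = 0) (hb : 0 < f.Y e.2.1) (x : Pt) :
    x ∈ arcImage e ↔ (x = e.1 ∨ x = e.2.2) ∨ (0 < f.Y x ∧
      (f.T x - f.T e.1) * (f.T x - f.T e.2.2) + f.Y x ^ 2 =
      (cos α / sin α) * |f.T e.2.2 - f.T e.1| * f.Y x) := by
  simp only [arcImage, mem_union, mem_insert_iff, mem_singleton_iff, mem_ofPred_eq]
  rw [f.sameSide ha hc he.1 x _ hb, he.2.2]
  apply or_congr_right
  apply and_congr_right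
  intro hx
  exact f.angle_iff α hα ha hc he.1 x hx

end Frame

theorem s_pos {α : ℝ} (hα : α ∈ Set.Ioo 0 (π/2)) : 0 < cos α / sin α :=
  div_pos (cos_pos_of_mem_Ioo ⟨by linarith [hα.1, pi_pos], hα.2⟩)
    (sin_pos_of_pos_of_lt_pi hα.1 (by linarith [hα.2, pi_pos]))

theorem frame_exists (P : Finset Pt) (hcard : 3 ≤ P.card) (hcol : Collinear ℝ (P : Set Pt)) :
    ∃ f : Frame, ∀ x ∈ P, f.Y x = 0 := by
  obtain ⟨p0, v, h⟩ := (collinear_iff_exists_forall_eq_smul_vadd _).mp hcol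
  have hv : v ≠ 0 := by
    rintro rfl
    have : P ⊆ {p0} := by
      intro x hx
      obtain ⟨r, hr⟩ := h x hx
      simpa using hr
    have := Finset.card_le_card this
    simp at this
    omega
  have hn : 0 < ‖v‖ := norm_pos_iff.mpr hv
  have hsq : ‖v‖ ^ 2 = v 0 ^ 2 + v 1 ^ 2 := by
    rw [EuclideanSpace.norm_sq_eq]; simp
  refine ⟨⟨p0, v 0 / ‖v‖, v 1 / ‖v‖, 1, ?_, by norm_num⟩, ?_⟩
  · field_simp; rw [hsq]
  · intro x hx
    obtain ⟨r, rfl⟩ := h x hx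
    simp [Frame.Y]; ring

/-- The interval of an edge. -/
def ivl (f : Frame) (e : Pt × Pt × Pt) : ℝ × ℝ :=
  (min (f.T e.1) (f.T e.2.2), max (f.T e.1) (f.T e.2.2))

theorem ivl_prop (f : Frame) (e : Pt × Pt × Pt) (q : ℝ) : 
    (q - f.T e.1) * (q - f.T e.2.2) = (q - (ivl f e).1) * (q - (ivl f e).2) ∧
    |f.T e.2.2 - f.T e.1| = (ivl f e).2 - (ivl f e).1 := by
  rcases le_total (f.T e.1) (f.T e.2.2) with h | h
  · simp only [ivl, min_eq_left h, max_eq_right h, true_and]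
    exact abs_of_nonneg (by linarith)
  · simp only [ivl, min_eq_right h, max_eq_left h]
    refine ⟨by ring, ?_⟩
    rw [abs_of_nonpos (by linarith)]; ring

/-- Bound for one side. -/
theorem side_bound (f : Frame) (α : ℝ) (hα : α ∈ Set.Ioo 0 (π/2)) (P : Finset Pt)
    (hP : ∀ x ∈ P, f.Y x = 0) (hne : P.Nonempty) (E : Finset (Pt × Pt × Pt))
    (hE : IsPlaneArcMultigraph α P E) (hpos : ∀ e ∈ E, 0 < f.Y e.2.1)
    (a z : Pt) (ha : a ∈ P) (hz : z ∈ P) (haz : f.T a < f.T z) (hmin : ∀ x ∈ P, f.T a ≤ f.T x)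
    (hmax : ∀ x ∈ P, f.T x ≤ f.T z) :
    E.card + 1 ≤ P.card ∧ (E.card + 2 ≤ P.card ∨ ∃ e ∈ E, edgeEndpoints e = {a, z}) := by
  classical
  obtain ⟨h1, h2, h3, h4⟩ := hE
  have hmem : ∀ e ∈ E, ∀ x : Pt, 0 < f.Y x → (x ∈ arcImage e ↔ 
      (f.T x - (ivl f e).1) * (f.T x - (ivl f e).2) + f.Y x ^ 2 =
      (cos α / sin α) * ((ivl f e).2 - (ivl f e).1) * f.Y x) := by
    intro e he x hx
    rw [f.mem_arc α hα e (h1 e he).1 (hP _ (h1 e he).2.1) (hP _ (h1 e he).2.2) (hpos e he),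
      (ivl_prop f e (f.T x)).1, (ivl_prop f e (f.T x)).2]
    have k1 : x ≠ e.1 := by rintro rfl; rw [hP _ (h1 e he).2.1] at hx; exact lt_irrefl _ hx
    have k2 : x ≠ e.2.2 := by rintro rfl; rw [hP _ (h1 e he).2.2] at hx; exact lt_irrefl _ hx
    simp [k1, k2, hx]
  have hnot : ∀ e ∈ E, ∀ g ∈ E, e ≠ g → ∀ x, 0 < f.Y x → x ∈ arcImage e → x ∈ arcImage g → False := by
    intro e he g hg heg x hx m1 m2
    have := (h4 e he g hg heg ⟨m1, m2⟩).1
    simp only [edgeEndpoints, mem_insert_iff, mem_singleton_iff] at this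
    rcases this with h | h
    · rw [h, hP _ (h1 e he).2.1] at hx; exact lt_irrefl _ hx
    · rw [h, hP _ (h1 e he).2.2] at hx; exact lt_irrefl _ hx
  have hself : ∀ e ∈ E, e.2.1 ∈ arcImage e := by
    intro e he
    right
    exact ⟨AffineSubspace.sSameSide_self_iff.mpr ⟨⟨e.1, left_mem_affineSpan_pair _ _ _⟩,
      (h1 e he).1.2.1⟩, rfl⟩
  have hinj : Set.InjOn (ivl f) (E : Set (Pt × Pt × Pt)) := by
    intro e he g hg h
    by_contra hc
    refine hnot e he g hg hc e.2.1 (hpos e he) (hself e he) ?_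
    rw [hmem g hg _ (hpos e he), ← h, ← hmem e he _ (hpos e he)]
    exact hself e he
  have hTinj : Set.InjOn f.T (P : Set Pt) := by
    intro x hx y hy h
    exact f.ext' h (by rw [hP x hx, hP y hy])
  have hcE : (E.image (ivl f)).card = E.card := Finset.card_image_of_injOn hinj
  have hcP : (P.image f.T).card = P.card := Finset.card_image_of_injOn hTinj
  have q1 : ∀ p ∈ E.image (ivl f), p.1 ∈ P.image f.T ∧ p.2 ∈ P.image f.T ∧ p.1 < p.2 := by
    intro p hp
    obtain ⟨e, he, rfl⟩ := Finset.mem_image.mp hp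
    have m1 := Finset.mem_image_of_mem f.T (h1 e he).2.1
    have m2 := Finset.mem_image_of_mem f.T (h1 e he).2.2
    have hTne : f.T e.1 ≠ f.T e.2.2 := fun h =>
      (h1 e he).1.1 (hTinj (h1 e he).2.1 (h1 e he).2.2 h)
    refine ⟨?_, ?_, ?_⟩
    · rcases min_choice (f.T e.1) (f.T e.2.2) with h | h <;> simp only [ivl, h] <;> assumption
    · rcases max_choice (f.T e.1) (f.T e.2.2) with h | h <;> simp only [ivl, h] <;> assumption
    · simpa [ivl] using hTne.symm
  have q2 : ∀ p ∈ E.image (ivl f), ∀ q ∈ E.image (ivl f),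
      p.1 < q.1 → q.1 ≤ p.2 → p.2 < q.2 → False := by
    intro p hp q hq c1 c2 c3
    obtain ⟨e, he, rfl⟩ := Finset.mem_image.mp hp
    obtain ⟨g, hg, rfl⟩ := Finset.mem_image.mp hq
    have heg : e ≠ g := by rintro rfl; exact lt_irrefl _ c1
    obtain ⟨x, y, hy, r1, r2⟩ := arcs_cross _ _ _ _ _ (s_pos hα) c1 c2 c3
    have hy' : 0 < f.Y (f.mk' x y) := by rwa [f.Y_mk]
    refine hnot e he g hg heg (f.mk' x y) hy' ?_ ?_
    · rw [hmem e he _ hy', f.Y_mk, f.T_mk]; exact r1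
    · rw [hmem g hg _ hy', f.Y_mk, f.T_mk]; exact r2
  refine ⟨?_, ?_⟩
  · rw [← hcE, ← hcP]
    exact comb_bound_s5 _ _ q1 q2 (hne.image _)
  · by_cases hF : (f.T a, f.T z) ∈ E.image (ivl f)
    · right
      obtain ⟨e, he, h⟩ := Finset.mem_image.mp hF
      refine ⟨e, he, ?_⟩
      simp only [ivl, Prod.mk.injEq] at h
      simp only [edgeEndpoints]
      rcases le_total (f.T e.1) (f.T e.2.2) with h' | h'
      · rw [min_eq_left h', max_eq_right h'] at h
        rw [hTinj (h1 e he).2.1 ha h.1, hTinj (h1 e he).2.2 hz h.2]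
      · rw [min_eq_right h', max_eq_left h'] at h
        rw [hTinj (h1 e he).2.2 ha h.1, hTinj (h1 e he).2.1 hz h.2, pair_comm]
    · left
      rw [← hcE, ← hcP]
      refine comb_bound' _ _ q1 q2 _ _ (Finset.mem_image_of_mem _ ha) (Finset.mem_image_of_mem _ hz)
        haz ?_ ?_ hF
      · intro x hx
        obtain ⟨y, hy, rfl⟩ := Finset.mem_image.mp hx
        exact hmin y hy
      · intro x hx
        obtain ⟨y, hy, rfl⟩ := Finset.mem_image.mp hx
        exact hmax y hy

theorem sub_multigraph {α : ℝ} {P : Finset Pt} {E E' : Finset (Pt × Pt × Pt)}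
    (h : IsPlaneArcMultigraph α P E) (hs : E' ⊆ E) : IsPlaneArcMultigraph α P E' :=
  ⟨fun e he => h.1 e (hs he), fun e he g hg => h.2.1 e (hs he) g (hs hg),
    fun e he => h.2.2.1 e (hs he), fun e he g hg => h.2.2.2 e (hs he) g (hs hg)⟩

theorem upper_s5 (f : Frame) (α : ℝ) (hα : α ∈ Set.Ioo 0 (π/2)) (P : Finset Pt)
    (hP : ∀ x ∈ P, f.Y x = 0) (E : Finset (Pt × Pt × Pt))
    (hE : IsPlaneArcMultigraph α P E) 
    (a z : Pt) (ha : a ∈ P) (hz : z ∈ P) (haz : f.T a < f.T z) (hmin : ∀ x ∈ P, f.T a ≤ f.T x)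
    (hmax : ∀ x ∈ P, f.T x ≤ f.T z) :
    E.card + 2 ≤ 2 * P.card ∧ (E.card + 3 ≤ 2 * P.card ∨
      ∃ e ∈ E, ∃ g ∈ E, e ≠ g ∧ edgeEndpoints e = edgeEndpoints g) := by
  classical
  have hne : ∀ e ∈ E, f.Y e.2.1 ≠ 0 := by
    intro e he h
    obtain ⟨⟨k1, k2, -⟩, m1, m2⟩ := hE.1 e he
    exact k2 ((f.mem_span (hP _ m1) (hP _ m2) k1 _).mpr h)
  have b1 := side_bound f α hα P hP ⟨a, ha⟩ (E.filter (fun e => 0 < f.Y e.2.1))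
    (sub_multigraph hE (Finset.filter_subset _ _)) (fun e he => (Finset.mem_filter.mp he).2)
    a z ha hz haz hmin hmax
  have b2 := side_bound f.flip α hα P (fun x hx => by rw [f.Y_flip, hP x hx, neg_zero])
    ⟨a, ha⟩ (E.filter (fun e => ¬ 0 < f.Y e.2.1))
    (sub_multigraph hE (Finset.filter_subset _ _))
    (fun e he => by
      have := Finset.mem_filter.mp he
      have h' := hne e this.1
      rw [f.Y_flip]
      have := lt_of_le_of_ne (not_lt.mp this.2) h'
      linarith)
    a z ha hz haz hmin hmax
  have hc := Finset.card_filter_add_card_filter_not (s := E) (fun e => 0 < f.Y e.2.1)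
  refine ⟨by omega, ?_⟩
  rcases b1.2 with h1 | ⟨e, he, h1⟩
  · left; omega
  · rcases b2.2 with h2 | ⟨g, hg, h2⟩
    · left; omega
    · right
      have he' := Finset.mem_filter.mp he
      have hg' := Finset.mem_filter.mp hg
      refine ⟨e, he'.1, g, hg'.1, ?_, by rw [h1, h2]⟩
      intro heq
      rw [heq] at he'
      exact absurd he'.2 hg'.2

theorem aux_true : True := trivial

/-- Edge from `a` to `c` on the positive side of the frame. -/
def Frame.edge (f : Frame) (α : ℝ) (a c : Pt) : Pt × Pt × Pt :=
  (a, f.mk' ((f.T a + f.T c) / 2) (|f.T c - f.T a| / 2 *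
    (cos α / sin α + √((cos α / sin α) ^ 2 + 1))), c)

theorem Frame.edge_spec (f : Frame) (α : ℝ) (hα : α ∈ Set.Ioo 0 (π/2)) (a c : Pt)
    (ha : f.Y a = 0) (hc : f.Y c = 0) (hac : a ≠ c) :
    0 < f.Y (f.edge α a c).2.1 ∧ IsArcEdge α (f.edge α a c) := by
  have hne : f.T c - f.T a ≠ 0 := by
    intro h
    exact hac (f.ext' (by linarith) (by rw [ha, hc]))
  have hs := s_pos hα
  have hpos : 0 < f.Y (f.edge α a c).2.1 := by
    simp only [edge, f.Y_mk]
    have := abs_pos.mpr hne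
    positivity
  refine ⟨hpos, hac, ?_, ?_⟩
  · change (f.edge α a c).2.1 ∉ affineSpan ℝ ({a, c} : Set Pt)
    rw [f.mem_span ha hc hac]
    exact hpos.ne'
  · change ∠ a (f.edge α a c).2.1 c = α
    rw [f.angle_iff α hα ha hc hac _ hpos]
    simp only [edge, f.Y_mk, f.T_mk]
    have hr : √((cos α / sin α) ^ 2 + 1) ^ 2 = (cos α / sin α) ^ 2 + 1 :=
      Real.sq_sqrt (by positivity)
    generalize √((cos α / sin α) ^ 2 + 1) = r at *
    generalize cos α / sin α = s at *
    have hab := sq_abs (f.T c - f.T a)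
    generalize |f.T c - f.T a| = L at *
    linear_combination (L ^ 2 / 4) * hr + (1 / 4) * hab

theorem lower_s5 (f : Frame) (α : ℝ) (hα : α ∈ Set.Ioo 0 (π/2)) (P : Finset Pt)
    (hP : ∀ x ∈ P, f.Y x = 0)
    (a z : Pt) (ha : a ∈ P) (hz : z ∈ P) (hmin : ∀ x ∈ P, f.T a ≤ f.T x)
    (hmax : ∀ x ∈ P, f.T x ≤ f.T z) (S1 S2 : Finset Pt) (hS1 : S1 ⊆ P.erase a)
    (hS2 : S2 ⊆ P.erase z) [DecidableEq (Pt × Pt × Pt)] :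
    IsPlaneArcMultigraph α P (S1.image (f.edge α a) ∪ S2.image (f.flip.edge α z)) ∧
    (S1.image (f.edge α a) ∪ S2.image (f.flip.edge α z)).card = S1.card + S2.card := by
  have hP' : ∀ x ∈ P, f.flip.Y x = 0 := fun x hx => by rw [f.Y_flip, hP x hx, neg_zero]
  have star : ∀ (f : Frame) (σ : ℝ) (a : Pt), a ∈ P → (∀ x ∈ P, f.Y x = 0) →
      (∀ x ∈ P, |f.T x - f.T a| = σ * (f.T x - f.T a)) → ∀ c ∈ P, ∀ d ∈ P, c ≠ a → d ≠ a →
      c ≠ d → ∀ x, 0 < f.Y x → x ∈ arcImage (f.edge α a c) → x ∈ arcImage (f.edge α a d) → False := by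
    intro f σ a ha hP hσ c hc d hd hca hda hcd x hx m1 m2
    have s1 := f.edge_spec α hα a c (hP a ha) (hP c hc) hca.symm
    have s2 := f.edge_spec α hα a d (hP a ha) (hP d hd) hda.symm
    rw [f.mem_arc α hα _ s1.2 (hP a ha) (hP c hc) s1.1] at m1
    rw [f.mem_arc α hα _ s2.2 (hP a ha) (hP d hd) s2.1] at m2
    have off : ∀ y ∈ P, x ≠ y := by
      rintro y hy rfl
      rw [hP x hy] at hx
      exact lt_irrefl _ hx
    have m1' := (m1.resolve_left (by rintro (h | h); exacts [off a ha h, off c hc h])).2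
    have m2' := (m2.resolve_left (by rintro (h | h); exacts [off a ha h, off d hd h])).2
    change (f.T x - f.T a) * (f.T x - f.T c) + f.Y x ^ 2 = (cos α / sin α) * |f.T c - f.T a| * f.Y x
      at m1'
    change (f.T x - f.T a) * (f.T x - f.T d) + f.Y x ^ 2 = (cos α / sin α) * |f.T d - f.T a| * f.Y x
      at m2'
    rw [hσ c hc] at m1'
    rw [hσ d hd] at m2'
    refine star_disj _ _ _ _ _ _ _ hx ?_ m1' m2'
    intro h
    exact hcd (f.ext' h (by rw [hP c hc, hP d hd]))
  set E := S1.image (f.edge α a) ∪ S2.image (f.flip.edge α z) with hEdef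
  have mem1 : ∀ c ∈ S1, c ∈ P ∧ c ≠ a := fun c hc =>
    ⟨Finset.mem_of_mem_erase (hS1 hc), Finset.ne_of_mem_erase (hS1 hc)⟩
  have mem2 : ∀ c ∈ S2, c ∈ P ∧ c ≠ z := fun c hc =>
    ⟨Finset.mem_of_mem_erase (hS2 hc), Finset.ne_of_mem_erase (hS2 hc)⟩
  have sp1 : ∀ c ∈ S1, 0 < f.Y (f.edge α a c).2.1 ∧ IsArcEdge α (f.edge α a c) := fun c hc =>
    f.edge_spec α hα a c (hP a ha) (hP c (mem1 c hc).1) (mem1 c hc).2.symm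
  have sp2 : ∀ c ∈ S2, 0 < f.flip.Y (f.flip.edge α z c).2.1 ∧ IsArcEdge α (f.flip.edge α z c) :=
    fun c hc =>
    f.flip.edge_spec α hα z c (hP' z hz) (hP' c (mem2 c hc).1) (mem2 c hc).2.symm
  have cases_E : ∀ e ∈ E, (∃ c ∈ S1, e = f.edge α a c) ∨ (∃ c ∈ S2, e = f.flip.edge α z c) := by
    intro e he
    rcases Finset.mem_union.mp he with h | h
    · obtain ⟨c, hc, rfl⟩ := Finset.mem_image.mp h
      exact Or.inl ⟨c, hc, rfl⟩
    · obtain ⟨c, hc, rfl⟩ := Finset.mem_image.mp h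
      exact Or.inr ⟨c, hc, rfl⟩
  have A : ∀ e ∈ E, IsArcEdge α e ∧ e.1 ∈ P ∧ e.2.2 ∈ P := by
    intro e he
    rcases cases_E e he with ⟨c, hc, rfl⟩ | ⟨c, hc, rfl⟩
    · exact ⟨(sp1 c hc).2, ha, (mem1 c hc).1⟩
    · exact ⟨(sp2 c hc).2, hz, (mem2 c hc).1⟩
  have pos1 : ∀ c ∈ S1, ∀ x ∈ arcImage (f.edge α a c),
      x ∈ edgeEndpoints (f.edge α a c) ∨ 0 < f.Y x := by
    intro c hc x hx
    rw [f.mem_arc α hα _ (sp1 c hc).2 (hP a ha) (hP c (mem1 c hc).1) (sp1 c hc).1] at hx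
    exact hx.imp (fun h => h) (fun h => h.1)
  have pos2 : ∀ c ∈ S2, ∀ x ∈ arcImage (f.flip.edge α z c),
      x ∈ edgeEndpoints (f.flip.edge α z c) ∨ 0 < f.flip.Y x := by
    intro c hc x hx
    rw [f.flip.mem_arc α hα _ (sp2 c hc).2 (hP' z hz) (hP' c (mem2 c hc).1) (sp2 c hc).1] at hx
    exact hx.imp (fun h => h) (fun h => h.1)
  have B : ∀ e ∈ E, ∀ x ∈ arcImage e, x ∈ edgeEndpoints e ∨ f.Y x ≠ 0 := by
    intro e he x hx
    rcases cases_E e he with ⟨c, hc, rfl⟩ | ⟨c, hc, rfl⟩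
    · exact (pos1 c hc x hx).imp (fun h => h) (fun h => h.ne')
    · refine (pos2 c hc x hx).imp (fun h => h) (fun h => ?_)
      rw [f.Y_flip] at h
      have h' : f.Y x < 0 := by linarith
      exact h'.ne
  have B' : ∀ e ∈ E, ∀ x ∈ edgeEndpoints e, f.Y x = 0 := by
    intro e he x hx
    rcases hx with h | h
    · rw [h]; exact hP _ (A e he).2.1
    · rw [h]; exact hP _ (A e he).2.2
  have D : ∀ e ∈ E, ∀ g ∈ E, e ≠ g → ∀ x ∈ arcImage e, x ∈ arcImage g → f.Y x = 0 := by
    intro e he g hg heg x hx hx'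
    by_contra hY
    have n1 : x ∉ edgeEndpoints e := fun h => hY (B' e he x h)
    have n2 : x ∉ edgeEndpoints g := fun h => hY (B' g hg x h)
    rcases cases_E e he with ⟨c, hc, rfl⟩ | ⟨c, hc, rfl⟩ <;>
    rcases cases_E g hg with ⟨d, hd, rfl⟩ | ⟨d, hd, rfl⟩
    · refine star f 1 a ha hP ?_ c (mem1 c hc).1 d (mem1 d hd).1 (mem1 c hc).2 (mem1 d hd).2 ?_ x
        ((pos1 c hc x hx).resolve_left n1) hx hx'
      · intro y hy
        rw [one_mul, abs_of_nonneg]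
        linarith [hmin y hy]
      · rintro rfl; exact heg rfl
    · have k1 := (pos1 c hc x hx).resolve_left n1
      have k2 := (pos2 d hd x hx').resolve_left n2
      rw [f.Y_flip] at k2
      linarith
    · have k1 := (pos2 c hc x hx).resolve_left n1
      have k2 := (pos1 d hd x hx').resolve_left n2
      rw [f.Y_flip] at k1
      linarith
    · refine star f.flip (-1) z hz hP' ?_ c (mem2 c hc).1 d (mem2 d hd).1 (mem2 c hc).2
        (mem2 d hd).2 ?_ x ((pos2 c hc x hx).resolve_left n1) hx hx'
      · intro y hy
        rw [f.T_flip, f.T_flip, abs_of_nonpos]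
        · ring
        · linarith [hmax y hy]
      · rintro rfl; exact heg rfl
  have hself : ∀ e ∈ E, e.2.1 ∈ arcImage e ∧ f.Y e.2.1 ≠ 0 := by
    intro e he
    have k := A e he
    refine ⟨Or.inr ⟨AffineSubspace.sSameSide_self_iff.mpr ⟨⟨e.1, left_mem_affineSpan_pair _ _ _⟩,
      k.1.2.1⟩, rfl⟩, fun h => k.1.2.1 ?_⟩
    rw [f.mem_span (hP _ k.2.1) (hP _ k.2.2) k.1.1]
    exact h
  refine ⟨⟨A, ?_, ?_, ?_⟩, ?_⟩
  · intro e he g hg heg h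
    have := hself e he
    exact this.2 (D e he g hg heg _ this.1 (h ▸ this.1))
  · intro e he v hv hx
    exact (B e he v hx).resolve_right (fun h => h (hP v hv))
  · rintro e he g hg heg x ⟨hx, hx'⟩
    have h0 := D e he g hg heg x hx hx'
    exact ⟨(B e he x hx).resolve_right (fun h => h h0), (B g hg x hx').resolve_right (fun h => h h0)⟩
  · rw [hEdef, Finset.card_union_of_disjoint, Finset.card_image_of_injective, 
      Finset.card_image_of_injective]
    · intro c d h
      exact congrArg (fun e : Pt × Pt × Pt => e.2.2) h
    · intro c d h
      exact congrArg (fun e : Pt × Pt × Pt => e.2.2) h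
    · rw [Finset.disjoint_left]
      intro e h1 h2
      obtain ⟨c, hc, rfl⟩ := Finset.mem_image.mp h1
      obtain ⟨d, hd, h⟩ := Finset.mem_image.mp h2
      have k1 := (sp1 c hc).1
      have k2 := (sp2 d hd).1
      rw [h, f.Y_flip] at k2
      linarith

/-- For `α ∈ (0, π/2)` and collinear `P` with `n ≥ 3` points, the maximum number of edges
of a plane `α`-arc graph on `P` is `2n - 3`, and of a plane `α`-arc multigraph is `2n - 2`. -/
theorem stmt_5 (α : ℝ) (hα : α ∈ Set.Ioo 0 (π/2)) (P : Finset Pt)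
    (hcard : 3 ≤ P.card) (hcol : Collinear ℝ (P : Set Pt)) :
    ((∀ E : Finset (Pt × Pt × Pt), IsPlaneArcGraph α P E → E.card ≤ 2 * P.card - 3) ∧
     (∃ E : Finset (Pt × Pt × Pt), IsPlaneArcGraph α P E ∧ E.card = 2 * P.card - 3)) ∧
    ((∀ E : Finset (Pt × Pt × Pt), IsPlaneArcMultigraph α P E → E.card ≤ 2 * P.card - 2) ∧
     (∃ E : Finset (Pt × Pt × Pt), IsPlaneArcMultigraph α P E ∧ E.card = 2 * P.card - 2)) := by
  classical
  obtain ⟨f, hP⟩ := frame_exists P hcard hcol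
  have hne : P.Nonempty := Finset.card_pos.mp (by omega)
  obtain ⟨a, ha, hmin⟩ := Finset.exists_min_image P f.T hne
  obtain ⟨z, hz, hmax⟩ := Finset.exists_max_image P f.T hne
  have haz' : a ≠ z := by
    rintro rfl
    have : P ⊆ {a} := by
      intro x hx
      rw [Finset.mem_singleton]
      exact f.ext' (le_antisymm (hmax x hx) (hmin x hx)) (by rw [hP x hx, hP a ha])
    have := Finset.card_le_card this
    simp at this
    omega
  have haz : f.T a < f.T z := by
    refine lt_of_le_of_ne (hmin z hz) (fun h => haz' (f.ext' h (by rw [hP a ha, hP z hz])))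
  refine ⟨⟨?_, ?_⟩, ?_, ?_⟩
  · intro E hE
    rcases (upper_s5 f α hα P hP E hE.1 a z ha hz haz hmin hmax).2 with h | ⟨e, he, g, hg, heg, h⟩
    · omega
    · exact (hE.2 e he g hg heg h).elim
  · have L := lower_s5 f α hα P hP a z ha hz hmin hmax (P.erase a) ((P.erase z).erase a)
      (Finset.Subset.refl _) (Finset.erase_subset _ _)
    refine ⟨_, ⟨L.1, ?_⟩, ?_⟩
    · have mixed : ∀ c d : Pt, d ≠ a →
          edgeEndpoints (f.edge α a c) ≠ edgeEndpoints (f.flip.edge α z d) := by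
        intro c d hd h
        have : a ∈ edgeEndpoints (f.flip.edge α z d) := by rw [← h]; exact Or.inl rfl
        rcases this with h | h
        · exact haz' h
        · exact hd (Eq.symm h)
      have same : ∀ (f : Frame) (a c d : Pt), c ≠ a →
          edgeEndpoints (f.edge α a c) = edgeEndpoints (f.edge α a d) → c = d := by
        intro f a c d hc h
        have : c ∈ edgeEndpoints (f.edge α a d) := by rw [← h]; exact Or.inr rfl
        rcases this with h | h
        · exact (hc h).elim
        · exact h
      intro e he g hg heg h
      rcases Finset.mem_union.mp he with he | he <;> rcases Finset.mem_union.mp hg with hg | hg <;>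
      obtain ⟨c, hc, rfl⟩ := Finset.mem_image.mp he <;>
      obtain ⟨d, hd, rfl⟩ := Finset.mem_image.mp hg
      · exact heg (by rw [same f a c d (Finset.ne_of_mem_erase hc) h])
      · exact mixed c d (Finset.ne_of_mem_erase hd) h
      · exact mixed d c (Finset.ne_of_mem_erase hc) h.symm
      · exact heg (by
          rw [same f.flip z c d (Finset.ne_of_mem_erase (Finset.mem_of_mem_erase hc)) h])
    · rw [L.2, Finset.card_erase_of_mem (Finset.mem_erase.mpr ⟨haz', ha⟩),
        Finset.card_erase_of_mem ha, Finset.card_erase_of_mem hz]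
      omega
  · intro E hE
    have := (upper_s5 f α hα P hP E hE a z ha hz haz hmin hmax).1
    omega
  · have L := lower_s5 f α hα P hP a z ha hz hmin hmax (P.erase a) (P.erase z)
      (Finset.Subset.refl _) (Finset.Subset.refl _)
    refine ⟨_, L.1, ?_⟩
    rw [L.2, Finset.card_erase_of_mem ha, Finset.card_erase_of_mem hz]
    omega
end
end
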